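/- arXiv:1706.03459 — 11 statements merged into one kernel-verified Lean document; each statement's English description precedes it below -/
import Mathlib

section
/- For every n, m ∈ ℕ and all score matrices s ∈ ℝ^{(n+1)×m} and s' ∈ ℝ^{n×(m+1)}, the matrix z ∈ [0,1]^{n×m} defined by z_{ij} = min{ e^{s_{ij}} / Σ_{k=1}^{n+1} e^{s_{kj}}, e^{s'_{ij}} / Σ_{k=1}^{m+1} e^{s'_{ik}} } is doubly substochastic: Σ_{i=1}^n z_{ij} ≤ 1 for every item j ∈ [m] and Σ_{j=1}^m z_{ij} ≤ 1 for every bidder i ∈ [n]. -/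
theorem softmax_sum_le (N : ℕ) (f : Fin (N + 1) → ℝ) :
    ∑ i : Fin N, Real.exp (f i.castSucc) / ∑ k, Real.exp (f k) ≤ 1 := by
  have hpos : 0 < ∑ k, Real.exp (f k) :=
    Finset.sum_pos (fun k _ => Real.exp_pos _) Finset.univ_nonempty
  rw [← Finset.sum_div, div_le_one hpos, Fin.sum_univ_castSucc]
  linarith [Real.exp_pos (f (Fin.last N))]

/-- The min-of-two-softmax allocation layer for unit-demand bidders produces a
doubly substochastic matrix: all entries are in `[0,1]`, and all row sums and
column sums are at most `1`. Index `n+1` of `s` is a dummy bidder row and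
index `m+1` of `s'` is a dummy item column. -/
theorem stmt1 (n m : ℕ)
    (s : Fin (n + 1) → Fin m → ℝ) (s' : Fin n → Fin (m + 1) → ℝ)
    (z : Fin n → Fin m → ℝ)
    (hz : ∀ i j, z i j =
      min (Real.exp (s i.castSucc j) / ∑ k, Real.exp (s k j))
          (Real.exp (s' i j.castSucc) / ∑ k, Real.exp (s' i k))) :
    (∀ i j, z i j ∈ Set.Icc (0 : ℝ) 1) ∧
    (∀ j, ∑ i, z i j ≤ 1) ∧
    (∀ i, ∑ j, z i j ≤ 1) := by
  have hcol : ∀ j, ∑ i, z i j ≤ 1 := fun j =>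
    (Finset.sum_le_sum fun i _ => (hz i j).trans_le (min_le_left _ _)).trans
      (softmax_sum_le n fun k => s k j)
  have hrow : ∀ i, ∑ j, z i j ≤ 1 := fun i =>
    (Finset.sum_le_sum fun j _ => (hz i j).trans_le (min_le_right _ _)).trans
      (softmax_sum_le m fun k => s' i k)
  have h0 : ∀ i j, 0 ≤ z i j := fun i j => by
    rw [hz]
    exact le_min (by positivity) (by positivity)
  refine ⟨fun i j => ⟨h0 i j, ?_⟩, hcol, hrow⟩
  exact (Finset.single_le_sum (f := fun i => z i j) (fun k _ => h0 k j)
    (Finset.mem_univ i)).trans (hcol j)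
end

section
/- Let n, m ∈ ℕ and let z ∈ (0,1)^{n×m} satisfy Σ_{i=1}^n z_{ij} < 1 for every j ∈ [m] and Σ_{j=1}^m z_{ij} < 1 for every i ∈ [n]. Then there exist score matrices s ∈ ℝ^{(n+1)×m} and s' ∈ ℝ^{n×(m+1)} such that for all i ∈ [n], j ∈ [m], z_{ij} = min{ e^{s_{ij}} / Σ_{k=1}^{n+1} e^{s_{kj}}, e^{s'_{ij}} / Σ_{k=1}^{m+1} e^{s'_{ik}} }. In other words, every strictly doubly substochastic allocation with strictly positive entries is representable by the min-of-two-softmax layer. -/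
/-- Every strictly doubly substochastic allocation with strictly positive
entries is representable by the unit-demand min-of-two-softmax layer:
there exist bidder-wise scores `s` (with a dummy row `n+1`) and item-wise
scores `s'` (with a dummy column `m+1`) whose normalized minima recover `z`. -/
theorem stmt2 (n m : ℕ) (z : Fin n → Fin m → ℝ)
    (hz : ∀ i j, z i j ∈ Set.Ioo (0 : ℝ) 1)
    (hcol : ∀ j, ∑ i, z i j < 1)
    (hrow : ∀ i, ∑ j, z i j < 1) :
    ∃ (s : Fin (n + 1) → Fin m → ℝ) (s' : Fin n → Fin (m + 1) → ℝ),
      ∀ i j, z i j =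
        min (Real.exp (s i.castSucc j) / ∑ k, Real.exp (s k j))
            (Real.exp (s' i j.castSucc) / ∑ k, Real.exp (s' i k)) := by
  refine ⟨fun k j => Fin.lastCases (motive := fun _ => ℝ) (Real.log (1 - ∑ i, z i j))
      (fun i => Real.log (z i j)) k,
    fun i k => Fin.lastCases (motive := fun _ => ℝ) (Real.log (1 - ∑ j, z i j))
      (fun j => Real.log (z i j)) k, ?_⟩
  intro i j
  have hc : 0 < 1 - ∑ i, z i j := sub_pos.mpr (hcol j)
  have hr : 0 < 1 - ∑ j, z i j := sub_pos.mpr (hrow i)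
  have hp : ∀ i j, Real.exp (Real.log (z i j)) = z i j := fun i j => Real.exp_log (hz i j).1
  simp only [Fin.sum_univ_castSucc, Fin.lastCases_castSucc, Fin.lastCases_last, hp,
    Real.exp_log hc, Real.exp_log hr, add_sub_cancel, div_one, min_self]
end

section
/- Let n, m ∈ ℕ with item set M = [m], and let z assign to each bidder i ∈ [n] and each nonempty bundle S ⊆ M a value z_{i,S} ∈ (0,1) such that Σ_{∅≠S⊆M} z_{i,S} < 1 for every bidder i and Σ_{i∈[n]} Σ_{S : j∈S} z_{i,S} < 1 for every item j ∈ M. Then there exist score families s : [n] × 2^M → ℝ and s^{(j)} : [n] × 2^M → ℝ (j ∈ M) such that for every bidder i and every nonempty bundle S, z_{i,S} = min{ s̄_{i,S}, s̄^{(j)}_{i,S} : j ∈ S }, where s̄_{i,S} = exp(s_{i,S}) / Σ_{S'⊆M} exp(s_{i,S'}) and s̄^{(j)}_{i,S} = exp(s^{(j)}_{i,S}) / Σ_{i'∈[n], S'⊆M} exp(s^{(j)}_{i',S'}). In other words, every strictly combinatorial-feasible allocation with strictly positive entries is representable by the combinatorial min-of-softmax layer. -/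
/-- Bidder-wise normalized score: softmax of bidder `i`'s scores over all bundles. -/
noncomputable def sbar {n m : ℕ} (s : Fin n → Finset (Fin m) → ℝ)
    (i : Fin n) (S : Finset (Fin m)) : ℝ :=
  Real.exp (s i S) / ∑ S' : Finset (Fin m), Real.exp (s i S')

/-- Item-wise normalized score: softmax of an item's scores over all
bidder–bundle pairs. -/
noncomputable def sbarItem {n m : ℕ} (t : Fin n → Finset (Fin m) → ℝ)
    (i : Fin n) (S : Finset (Fin m)) : ℝ :=
  Real.exp (t i S) / ∑ i' : Fin n, ∑ S' : Finset (Fin m), Real.exp (t i' S')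

/-- Every strictly combinatorial-feasible allocation with strictly positive
entries on nonempty bundles is representable by the combinatorial
min-of-softmax layer. -/
theorem stmt4 (n m : ℕ)
    (z : Fin n → Finset (Fin m) → ℝ)
    (hz01 : ∀ i S, S.Nonempty → z i S ∈ Set.Ioo (0 : ℝ) 1)
    (hrow : ∀ i,
      ∑ S ∈ Finset.univ.filter (fun S : Finset (Fin m) => S.Nonempty), z i S < 1)
    (hitem : ∀ j : Fin m,
      ∑ i, ∑ S ∈ Finset.univ.filter (fun S : Finset (Fin m) => j ∈ S), z i S < 1) :
    ∃ (s : Fin n → Finset (Fin m) → ℝ) (sI : Fin m → Fin n → Finset (Fin m) → ℝ),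
      ∀ i S, ∀ hS : S.Nonempty,
        z i S = min (sbar s i S) (S.inf' hS fun j => sbarItem (sI j) i S) := by
  classical
  set w : Fin n → Finset (Fin m) → ℝ := fun i S => if S.Nonempty then z i S else
    1 - ∑ S ∈ Finset.univ.filter (fun S : Finset (Fin m) => S.Nonempty), z i S with hw
  set c : Fin m → ℝ := fun j =>
    (1 - ∑ i, ∑ S ∈ Finset.univ.filter (fun S : Finset (Fin m) => j ∈ S), z i S) /
      ((n : ℝ) * ((Finset.univ.filter (fun S : Finset (Fin m) => ¬ j ∈ S)).card : ℝ)) with hc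
  set v : Fin m → Fin n → Finset (Fin m) → ℝ := fun j i S => if j ∈ S then z i S else c j with hv
  refine ⟨fun i S => Real.log (w i S), fun j i S => Real.log (v j i S), ?_⟩
  intro i S hS
  have hwpos : ∀ S, 0 < w i S := by
    intro S
    by_cases h : S.Nonempty
    · simpa only [hw, if_pos h] using (hz01 i S h).1
    · simp only [hw, if_neg h]
      linarith [hrow i]
  have hwsum : ∑ S, w i S = 1 := by
    have h0 : Finset.univ.filter (fun S : Finset (Fin m) => ¬ S.Nonempty) = {∅} := by
      ext S
      simp [Finset.not_nonempty_iff_eq_empty]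
    simp only [hw]
    rw [Finset.sum_ite, h0, Finset.sum_singleton]
    ring
  have h1 : sbar (fun i S => Real.log (w i S)) i S = z i S := by
    unfold sbar
    simp only [Real.exp_log (hwpos _)]
    rw [hwsum, div_one]
    simp only [hw, if_pos hS]
  have hn : (0 : ℝ) < n := by
    have : 0 < n := lt_of_le_of_lt (Nat.zero_le _) i.2
    exact_mod_cast this
  have h2 : ∀ j ∈ S, sbarItem (fun i S => Real.log (v j i S)) i S = z i S := by
    intro j hj
    have hk : (0 : ℝ) < ((Finset.univ.filter (fun S : Finset (Fin m) => ¬ j ∈ S)).card : ℝ) := by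
      have : 0 < (Finset.univ.filter (fun S : Finset (Fin m) => ¬ j ∈ S)).card :=
        Finset.card_pos.2 ⟨∅, by simp⟩
      exact_mod_cast this
    have hcpos : 0 < c j := div_pos (by linarith [hitem j]) (mul_pos hn hk)
    have hvpos : ∀ i S, 0 < v j i S := by
      intro i S
      by_cases h : j ∈ S
      · simpa only [hv, if_pos h] using (hz01 i S ⟨j, h⟩).1
      · simpa only [hv, if_neg h] using hcpos
    have hvsum : ∑ i, ∑ S, v j i S = 1 := by
      simp only [hv, Finset.sum_ite, Finset.sum_add_distrib, Finset.sum_const, nsmul_eq_mul,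
        Finset.card_univ, Fintype.card_fin]
      rw [← mul_assoc]
      simp only [hc]
      rw [mul_div_cancel₀ _ (mul_pos hn hk).ne']
      ring
    unfold sbarItem
    simp only [Real.exp_log (hvpos _ _)]
    rw [hvsum, div_one]
    simp only [hv, if_pos hj]
  rw [h1, Finset.inf'_congr hS rfl h2, Finset.inf'_const, min_self]
end

section
/- Let k ≥ 1, let T_0, …, T_k ∈ ℕ be layer widths with T = max_ℓ T_ℓ, let B > 0, Φ ≥ 1, W ≥ 1, and for each ℓ ∈ [k] let φ_ℓ : ℝ^{T_ℓ} → [−B, B]^{T_ℓ} satisfy ‖φ_ℓ(s) − φ_ℓ(s')‖_1 ≤ Φ‖s − s'‖_1 for all s, s'. Let w_ℓ, ŵ_ℓ ∈ ℝ^{T_ℓ × T_{ℓ−1}} be matrices with ‖w_ℓ‖_1 ≤ W and ‖w_ℓ − ŵ_ℓ‖_1 ≤ ε_0 for every ℓ ∈ [k], where ‖A‖_1 = max_j Σ_i |A_{ij}|. Define f(x) = φ_k(w_k φ_{k−1}(⋯ φ_1(w_1 x) ⋯)) and f̂(x) = φ_k(ŵ_k φ_{k−1}(⋯ φ_1(ŵ_1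 x) ⋯)). Then for every input x ∈ ℝ^{T_0} with ‖x‖_1 ≤ B, ‖f(x) − f̂(x)‖_1 ≤ B·T·ε_0·(2ΦW)^k. -/
/-- Forward pass of a feed-forward network: layer `ℓ+1` applies the linear map
given by the matrix `w ℓ` followed by the activation `φ ℓ`. -/
noncomputable def forward (T : ℕ → ℕ)
    (φ : ∀ ℓ : ℕ, (Fin (T (ℓ + 1)) → ℝ) → (Fin (T (ℓ + 1)) → ℝ))
    (w : ∀ ℓ : ℕ, Fin (T (ℓ + 1)) → Fin (T ℓ) → ℝ) :
    ∀ ℓ : ℕ, (Fin (T 0) → ℝ) → (Fin (T ℓ) → ℝ)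
  | 0 => fun x => x
  | (ℓ + 1) => fun x => φ ℓ (fun i => ∑ j, w ℓ i j * forward T φ w ℓ x j)

theorem l1_mulVec_le {m n : ℕ} (A : Fin m → Fin n → ℝ) (C : ℝ)
    (hA : ∀ j, ∑ i, |A i j| ≤ C) (z : Fin n → ℝ) :
    ∑ i, |∑ j, A i j * z j| ≤ C * ∑ j, |z j| := by
  calc ∑ i, |∑ j, A i j * z j| ≤ ∑ i, ∑ j, |A i j| * |z j| := by
        apply Finset.sum_le_sum
        intro i _
        refine (Finset.abs_sum_le_sum_abs _ _).trans (le_of_eq ?_)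
        simp only [abs_mul]
    _ = ∑ j, (∑ i, |A i j|) * |z j| := by
        rw [Finset.sum_comm]
        simp only [Finset.sum_mul]
    _ ≤ ∑ j, C * |z j| := by
        apply Finset.sum_le_sum
        intro j _
        exact mul_le_mul_of_nonneg_right (hA j) (abs_nonneg _)
    _ = C * ∑ j, |z j| := by rw [Finset.mul_sum]

/-- Perturbation bound for feed-forward networks with entrywise-bounded,
ℓ1-Lipschitz activations: if each layer's weight matrix is perturbed by at
most `ε₀` in the column-sum norm, the output changes by at most
`B * T * ε₀ * (2ΦW)^k` in ℓ1-norm, where `T` is the maximum layer width. -/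
theorem stmt5 (k : ℕ) (hk : 1 ≤ k) (T : ℕ → ℕ)
    (B Φ W ε₀ : ℝ) (hB : 0 < B) (hΦ : 1 ≤ Φ) (hW : 1 ≤ W) (hε₀ : 0 ≤ ε₀)
    (φ : ∀ ℓ : ℕ, (Fin (T (ℓ + 1)) → ℝ) → (Fin (T (ℓ + 1)) → ℝ))
    (hφbound : ∀ ℓ s i, φ ℓ s i ∈ Set.Icc (-B) B)
    (hφlip : ∀ ℓ s s', ∑ i, |φ ℓ s i - φ ℓ s' i| ≤ Φ * ∑ i, |s i - s' i|)
    (w wh : ∀ ℓ : ℕ, Fin (T (ℓ + 1)) → Fin (T ℓ) → ℝ)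
    (hw : ∀ ℓ j, ∑ i, |w ℓ i j| ≤ W)
    (hdiff : ∀ ℓ j, ∑ i, |w ℓ i j - wh ℓ i j| ≤ ε₀)
    (x : Fin (T 0) → ℝ) (hx : ∑ j, |x j| ≤ B) :
    ∑ i, |forward T φ w k x i - forward T φ wh k x i| ≤
      B * (((Finset.range (k + 1)).sup T : ℕ) : ℝ) * ε₀ * (2 * Φ * W) ^ k := by
  set M : ℝ := (((Finset.range (k + 1)).sup T : ℕ) : ℝ) with hM
  have hTM : ∀ l, l ≤ k → (T l : ℝ) ≤ M := by
    intro l hl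
    rw [hM]
    exact_mod_cast Finset.le_sup (f := T) (Finset.mem_range.mpr (by omega))
  have hM0 : 0 ≤ M := by rw [hM]; positivity
  have hnorm : ∀ l, ∑ j, |forward T φ wh l x j| ≤ B * T l := by
    intro l
    cases l with
    | zero =>
      simp only [forward]
      rcases Nat.eq_zero_or_pos (T 0) with h | h
      · have : IsEmpty (Fin (T 0)) := by rw [h]; infer_instance
        simp [h]
      · have h1 : (1 : ℝ) ≤ T 0 := by exact_mod_cast h
        nlinarith
    | succ l =>
      have : ∑ j, |forward T φ wh (l + 1) x j| ≤ ∑ _j : Fin (T (l + 1)), B := by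
        apply Finset.sum_le_sum
        intro j _
        exact abs_le.mpr (hφbound l _ j)
      refine this.trans (le_of_eq ?_)
      simp [mul_comm]
  have hΦW : Φ ≤ Φ * W := by nlinarith
  have hC : 0 ≤ B * M * ε₀ := by positivity
  have key : ∀ l, l ≤ k → ∑ i, |forward T φ w l x i - forward T φ wh l x i| ≤
      B * M * ε₀ * ((2 * Φ * W) ^ l - 1) := by
    intro l
    induction l with
    | zero => intro _; simp [forward]
    | succ l ih =>
      intro hl
      have ih' := ih (by omega)
      have h1 := hφlip l (fun i => ∑ j, w l i j * forward T φ w l x j)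
        (fun i => ∑ j, wh l i j * forward T φ wh l x j)
      have h2 := l1_mulVec_le (w l) W (hw l)
        (fun j => forward T φ w l x j - forward T φ wh l x j)
      have h3 := l1_mulVec_le (fun i j => w l i j - wh l i j) ε₀ (hdiff l)
        (fun j => forward T φ wh l x j)
      have h4 : ∑ i, |∑ j, w l i j * forward T φ w l x j
          - ∑ j, wh l i j * forward T φ wh l x j| ≤
          ∑ i, |∑ j, w l i j * (forward T φ w l x j - forward T φ wh l x j)| +
          ∑ i, |∑ j, (w l i j - wh l i j) * forward T φ wh l x j| := by
        rw [← Finset.sum_add_distrib]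
        apply Finset.sum_le_sum
        intro i _
        refine le_trans (le_of_eq ?_) (abs_add_le _ _)
        congr 1
        rw [← Finset.sum_sub_distrib, ← Finset.sum_add_distrib]
        apply Finset.sum_congr rfl
        intro j _
        ring
      have h5 : ε₀ * ∑ j, |forward T φ wh l x j| ≤ B * M * ε₀ := by
        have := (hnorm l).trans (mul_le_mul_of_nonneg_left (hTM l (by omega)) hB.le)
        calc _ ≤ ε₀ * (B * M) := mul_le_mul_of_nonneg_left this hε₀
          _ = _ := by ring
      have h6 := mul_le_mul_of_nonneg_left ih' (by linarith : (0 : ℝ) ≤ W)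
      have h7 : Φ * (W * (B * M * ε₀ * ((2 * Φ * W) ^ l - 1)) + B * M * ε₀) ≤
          B * M * ε₀ * ((2 * Φ * W) ^ (l + 1) - 1) := by
        have hp : 1 ≤ (2 * Φ * W) ^ l := one_le_pow₀ (by nlinarith)
        have : Φ * W * ((2 * Φ * W) ^ l - 1) + Φ ≤ (2 * Φ * W) ^ (l + 1) - 1 := by
          rw [pow_succ]
          nlinarith
        have := mul_le_mul_of_nonneg_left this hC
        linarith
      refine le_trans h1 (le_trans (mul_le_mul_of_nonneg_left ?_ (by linarith)) h7)
      exact h4.trans (by linarith)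
  refine (key k le_rfl).trans (mul_le_mul_of_nonneg_left (by linarith) hC)
end

section
/- Let k ≥ 1, let T_0, …, T_k ∈ ℕ be layer widths with T = max_ℓ T_ℓ and d = Σ_{ℓ=1}^k T_ℓ T_{ℓ−1} the total number of parameters, let B > 0, Φ ≥ 1, W ≥ 1, and for each ℓ ∈ [k] let φ_ℓ : ℝ^{T_ℓ} → [−B, B]^{T_ℓ} be Φ-Lipschitz with respect to the ℓ1-norm. Let F_k be the class of all functions f(x) = φ_k(w_k φ_{k−1}(⋯ φ_1(w_1 x) ⋯)) whose parameter matrices w_ℓ have all entries in [−W, W] and satisfy ‖w_ℓ‖_1 ≤ W. Then for every ε > 0 there is a finite set F̂ of functions from ℝ^{T_0} to ℝ^{T_k} with |F̂| ≤ ⌈2·B·T²·W·(2ΦW)^k / ε⌉^d such that for every f ∈ F_k there exists f̂ ∈ F̂ with sup_{x : ‖x‖_1 ≤ B} ‖f(x) − f̂(x)‖_1 ≤ ε. -/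
theorem grid_aux (W : ℝ) (hW : 0 < W) (N : ℕ) (hN : 0 < N) (v : ℝ) (hv : |v| ≤ W) :
    ∃ i : Fin N, |v - (-W + (2 * (i : ℕ) + 1) * (W / N))| ≤ W / N := by
  have hN' : (0 : ℝ) < N := by exact_mod_cast hN
  obtain ⟨h1, h2⟩ := abs_le.mp hv
  set δ : ℝ := W / N with hδ
  have hδ0 : 0 < δ := by positivity
  have hNδ : N * δ = W := by rw [hδ]; field_simp
  set t : ℝ := (v + W) / (2 * δ) with ht
  have ht0 : 0 ≤ t := by apply div_nonneg <;> linarith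
  have hvt : v = -W + 2 * t * δ := by rw [ht]; field_simp; ring
  have htN : t ≤ N := by
    rw [ht, div_le_iff₀ (by positivity)]; nlinarith
  have key : ∃ i : ℕ, i < N ∧ (i : ℝ) ≤ t ∧ t ≤ i + 1 := by
    by_cases h : ⌊t⌋₊ < N
    · exact ⟨⌊t⌋₊, h, Nat.floor_le ht0, (Nat.lt_floor_add_one t).le⟩
    · push Not at h
      have h3 : (N : ℝ) ≤ t := (Nat.le_floor_iff ht0).mp h
      refine ⟨N - 1, by omega, ?_, ?_⟩ <;> rw [Nat.cast_sub hN] <;> push_cast <;> linarith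
  obtain ⟨i, hi, hi1, hi2⟩ := key
  refine ⟨⟨i, hi⟩, ?_⟩
  rw [hvt, abs_le]
  constructor <;> simp only [] <;> nlinarith

theorem matvec_aux {m n : ℕ} (w w' : Fin m → Fin n → ℝ) (x y : Fin n → ℝ) (W δ : ℝ)
    (hw : ∀ j, ∑ i, |w i j| ≤ W) (hd : ∀ i j, |w i j - w' i j| ≤ δ) :
    ∑ i, |(∑ j, w i j * x j) - ∑ j, w' i j * y j|
      ≤ W * ∑ j, |x j - y j| + m * δ * ∑ j, |y j| := by
  have h1 : ∀ i, |(∑ j, w i j * x j) - ∑ j, w' i j * y j|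
      ≤ ∑ j, |w i j| * |x j - y j| + ∑ j, δ * |y j| := by
    intro i
    rw [← Finset.sum_sub_distrib, ← Finset.sum_add_distrib]
    refine (Finset.abs_sum_le_sum_abs _ _).trans (Finset.sum_le_sum fun j _ => ?_)
    have : w i j * x j - w' i j * y j = w i j * (x j - y j) + (w i j - w' i j) * y j := by ring
    rw [this]
    refine (abs_add_le _ _).trans ?_
    rw [abs_mul, abs_mul]
    gcongr
    exact hd i j
  refine (Finset.sum_le_sum fun i _ => h1 i).trans ?_
  rw [Finset.sum_add_distrib, Finset.sum_comm]
  refine add_le_add ?_ (le_of_eq ?_)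
  · rw [Finset.mul_sum]
    refine Finset.sum_le_sum fun j _ => ?_
    rw [← Finset.sum_mul]
    gcongr
    exact hw j
  · simp [← Finset.mul_sum, mul_assoc]

theorem err_aux (k : ℕ) (T : ℕ → ℕ) (τ : ℕ) (hT : ∀ ℓ ≤ k, T ℓ ≤ τ)
    (B Φ W δ : ℝ) (hB : 0 < B) (hΦ : 1 ≤ Φ) (hW : 1 ≤ W) (hδ : 0 ≤ δ)
    (φ : ∀ ℓ : ℕ, (Fin (T (ℓ + 1)) → ℝ) → (Fin (T (ℓ + 1)) → ℝ))
    (hφbound : ∀ ℓ s i, φ ℓ s i ∈ Set.Icc (-B) B)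
    (hφlip : ∀ ℓ s s', ∑ i, |φ ℓ s i - φ ℓ s' i| ≤ Φ * ∑ i, |s i - s' i|)
    (w w' : ∀ ℓ : ℕ, Fin (T (ℓ + 1)) → Fin (T ℓ) → ℝ)
    (hw : ∀ ℓ j, ∑ i, |w ℓ i j| ≤ W)
    (hd : ∀ ℓ < k, ∀ i j, |w ℓ i j - w' ℓ i j| ≤ δ)
    (x : Fin (T 0) → ℝ) (hx : (∑ j, |x j|) ≤ B) (ℓ : ℕ) (hℓ : ℓ ≤ k) :
    ∑ i, |forward T φ w ℓ x i - forward T φ w' ℓ x i|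
      ≤ ((τ : ℝ) ^ 2 * δ * B) * ℓ * (Φ * W) ^ ℓ := by
  induction ℓ with
  | zero => simp [forward]
  | succ ℓ ih =>
    have ih := ih (by omega)
    have hM : 1 ≤ Φ * W := one_le_mul_of_one_le_of_one_le hΦ hW
    have hs : (T (ℓ + 1) : ℝ) * ∑ j, |forward T φ w' ℓ x j| ≤ (τ : ℝ) ^ 2 * B := by
      have h1 : (T (ℓ + 1) : ℝ) ≤ τ := by exact_mod_cast hT _ hℓ
      have h0 : (T ℓ : ℝ) ≤ τ := by exact_mod_cast hT ℓ (by omega)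
      rcases ℓ with _ | ℓ
      · have h2 : (τ : ℝ) ≤ (τ : ℝ) ^ 2 := by
          exact_mod_cast Nat.le_self_pow (by norm_num) τ
        simp only [forward]
        exact mul_le_mul (h1.trans h2) hx (by positivity) (by positivity)
      · have h2 : ∑ j, |forward T φ w' (ℓ + 1) x j| ≤ τ * B := by
          calc _ ≤ ∑ j : Fin (T (ℓ + 1)), B := Finset.sum_le_sum fun j _ => by
                  simp only [forward]
                  exact abs_le.mpr (hφbound _ _ _)
            _ = T (ℓ + 1) * B := by simp
            _ ≤ _ := by gcongr
        calc _ ≤ (τ : ℝ) * (τ * B) := mul_le_mul h1 h2 (by positivity) (by positivity)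
          _ = _ := by ring
    have hmv := matvec_aux (w ℓ) (w' ℓ) (forward T φ w ℓ x) (forward T φ w' ℓ x) W δ
      (hw ℓ) (hd ℓ (by omega))
    set D : ℝ := (τ : ℝ) ^ 2 * δ * B with hD
    have hD0 : 0 ≤ D := by positivity
    simp only [forward]
    refine (hφlip ℓ _ _).trans ?_
    calc _ ≤ Φ * (W * (D * ℓ * (Φ * W) ^ ℓ) + D) := by
          refine mul_le_mul_of_nonneg_left (hmv.trans (add_le_add ?_ ?_)) (by linarith)
          · exact mul_le_mul_of_nonneg_left ih (by linarith)
          · have := mul_le_mul_of_nonneg_left hs hδ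
            rw [hD]; linarith
      _ = D * ℓ * (Φ * W) ^ (ℓ + 1) + D * Φ := by ring
      _ ≤ D * ℓ * (Φ * W) ^ (ℓ + 1) + D * (Φ * W) ^ (ℓ + 1) := by
          gcongr
          calc Φ ≤ Φ * W := by nlinarith
            _ ≤ _ := le_self_pow₀ hM (by omega)
      _ = _ := by push_cast; ring

/-- Covering-number bound for feed-forward neural networks: the class of
depth-`k` networks with entrywise-bounded, ℓ1-Lipschitz activations, weight
entries in `[-W,W]` and column-sum norm at most `W`, admits a cover of size
at most `⌈2BT²W(2ΦW)^k/ε⌉^d` at ℓ1-radius `ε` over inputs with `‖x‖₁ ≤ B`,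
where `T` is the maximum layer width and `d` the total number of parameters. -/
theorem stmt6 (k : ℕ) (hk : 1 ≤ k) (T : ℕ → ℕ)
    (B Φ W : ℝ) (hB : 0 < B) (hΦ : 1 ≤ Φ) (hW : 1 ≤ W)
    (φ : ∀ ℓ : ℕ, (Fin (T (ℓ + 1)) → ℝ) → (Fin (T (ℓ + 1)) → ℝ))
    (hφbound : ∀ ℓ s i, φ ℓ s i ∈ Set.Icc (-B) B)
    (hφlip : ∀ ℓ s s', ∑ i, |φ ℓ s i - φ ℓ s' i| ≤ Φ * ∑ i, |s i - s' i|)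
    (ε : ℝ) (hε : 0 < ε) :
    ∃ F : Finset ((Fin (T 0) → ℝ) → (Fin (T k) → ℝ)),
      F.card ≤
        (⌈2 * B * ((((Finset.range (k + 1)).sup T : ℕ) : ℝ)) ^ 2 * W * (2 * Φ * W) ^ k / ε⌉₊)
          ^ (∑ ℓ ∈ Finset.range k, T (ℓ + 1) * T ℓ) ∧
      ∀ w : ∀ ℓ : ℕ, Fin (T (ℓ + 1)) → Fin (T ℓ) → ℝ,
        (∀ ℓ i j, |w ℓ i j| ≤ W) →
        (∀ ℓ j, ∑ i, |w ℓ i j| ≤ W) →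
        ∃ fh ∈ F, ∀ x : Fin (T 0) → ℝ, (∑ j, |x j|) ≤ B →
          ∑ i, |forward T φ w k x i - fh x i| ≤ ε := by
  classical
  set τ : ℕ := (Finset.range (k + 1)).sup T with hτ
  have hT : ∀ ℓ ≤ k, T ℓ ≤ τ := fun ℓ h => Finset.le_sup (f := T) (by simp; omega)
  set N : ℕ := ⌈2 * B * (τ : ℝ) ^ 2 * W * (2 * Φ * W) ^ k / ε⌉₊ with hNdef
  rcases Nat.eq_zero_or_pos τ with h0 | hτpos
  · have hz : ∀ ℓ ≤ k, T ℓ = 0 := fun ℓ h => by have := hT ℓ h; omega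
    have hd : ∑ ℓ ∈ Finset.range k, T (ℓ + 1) * T ℓ = 0 :=
      Finset.sum_eq_zero fun ℓ h => by
        rw [hz ℓ (Finset.mem_range.mp h).le, mul_zero]
    refine ⟨{fun _ _ => 0}, by rw [hd]; simp, fun w _ _ => ⟨_, Finset.mem_singleton_self _, ?_⟩⟩
    intro x _
    have : IsEmpty (Fin (T k)) := by rw [hz k le_rfl]; infer_instance
    simpa using hε.le
  · have hτ' : (0 : ℝ) < τ := by exact_mod_cast hτpos
    have hΦ0 : 0 < Φ := by linarith
    have hW0 : 0 < W := by linarith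
    have hN : 0 < N := Nat.ceil_pos.mpr (by positivity)
    have hN' : (0 : ℝ) < N := by exact_mod_cast hN
    have hNle : 2 * B * (τ : ℝ) ^ 2 * W * (2 * Φ * W) ^ k ≤ N * ε :=
      (div_le_iff₀ hε).mp (Nat.le_ceil _)
    let P := (Σ ℓ : Fin k, Fin (T (ℓ + 1)) × Fin (T ℓ)) → Fin N
    let wt : P → ∀ ℓ : ℕ, Fin (T (ℓ + 1)) → Fin (T ℓ) → ℝ := fun p ℓ i j =>
      if h : ℓ < k then -W + (2 * ((p ⟨⟨ℓ, h⟩, (i, j)⟩ : Fin N) : ℕ) + 1) * (W / N) else 0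
    refine ⟨Finset.univ.image fun p : P => forward T φ (wt p) k, ?_, ?_⟩
    · refine Finset.card_image_le.trans (le_of_eq ?_)
      simp [P, Finset.sum_range]
    · intro w hw1 hw2
      choose g hg using fun (ℓ : ℕ) i j => grid_aux W hW0 N hN (w ℓ i j) (hw1 ℓ i j)
      let p : P := fun a => g a.1 a.2.1 a.2.2
      refine ⟨_, Finset.mem_image_of_mem _ (Finset.mem_univ p), fun x hx => ?_⟩
      refine (err_aux k T τ hT B Φ W (W / N) hB hΦ hW (by positivity) φ hφbound hφlip w (wt p)
        hw2 ?_ x hx k le_rfl).trans ?_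
      · intro ℓ hℓ i j
        simp only [wt, hℓ, dif_pos, p]
        exact hg ℓ i j
      · have hk2 : (k : ℝ) ≤ 2 ^ k := by exact_mod_cast (Nat.lt_two_pow_self (n := k)).le
        have e : (τ : ℝ) ^ 2 * (W / N) * B * k * (Φ * W) ^ k
            = (k * (B * (τ : ℝ) ^ 2 * W * (Φ * W) ^ k)) / N := by field_simp
        rw [e, div_le_iff₀ hN']
        have hp : 0 ≤ B * (τ : ℝ) ^ 2 * W * (Φ * W) ^ k := by positivity
        have h3 := mul_le_mul_of_nonneg_right hk2 hp
        have e2 : 2 * B * (τ : ℝ) ^ 2 * W * (2 * Φ * W) ^ k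
            = 2 * (2 ^ k * (B * (τ : ℝ) ^ 2 * W * (Φ * W) ^ k)) := by
          rw [mul_assoc 2 Φ W, mul_pow 2 (Φ * W)]; ring
        have h4 : 0 ≤ 2 ^ k * (B * (τ : ℝ) ^ 2 * W * (Φ * W) ^ k) := by positivity
        linarith
end

section
/- For every n ≥ 1 and all u, u' ∈ ℝ^n, the softmax map softmax_i(u) = e^{u_i} / Σ_{k=1}^n e^{u_k} satisfies ‖softmax(u) − softmax(u')‖_1 ≤ ‖u − u'‖_1, i.e. Σ_{i=1}^n |softmax_i(u) − softmax_i(u')| ≤ Σ_{i=1}^n |u_i − u'_i|. -/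
theorem softmax_aux (n : ℕ) (e s d : Fin n → ℝ) (he : ∀ i, 0 < e i) (hs : ∀ i, |s i| ≤ 1)
    (hZ : 0 < ∑ k, e k) :
    ((∑ i, s i * (e i * d i)) * (∑ k, e k) - (∑ i, s i * e i) * (∑ k, e k * d k)) /
      (∑ k, e k) ^ 2 ≤ ∑ i, |d i| := by
  rw [div_le_iff₀ (by positivity), Finset.sum_mul, Finset.mul_sum, ← Finset.sum_sub_distrib,
    Finset.sum_mul]
  refine Finset.sum_le_sum fun k _ => ?_
  set Z := ∑ k, e k with hZd
  have h1 : |∑ i ∈ Finset.univ.erase k, s i * e i| ≤ ∑ i ∈ Finset.univ.erase k, e i := by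
    refine (Finset.abs_sum_le_sum_abs _ _).trans (Finset.sum_le_sum fun i _ => ?_)
    rw [abs_mul, abs_of_pos (he i)]
    nlinarith [hs i, he i]
  have h2 := Finset.add_sum_erase Finset.univ e (Finset.mem_univ k)
  have h3 := Finset.add_sum_erase Finset.univ (fun i => s i * e i) (Finset.mem_univ k)
  have hR : 0 ≤ ∑ i ∈ Finset.univ.erase k, e i := (abs_nonneg _).trans h1
  rw [← h3]
  set R := ∑ i ∈ Finset.univ.erase k, e i
  set N := ∑ i ∈ Finset.univ.erase k, s i * e i
  have hZ2 : Z = e k + R := h2.symm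
  have h4 : |e k * (s k * R - N)| ≤ Z ^ 2 := by
    rw [abs_mul, abs_of_pos (he k)]
    have h5 : |s k * R - N| ≤ 2 * R := by
      refine (abs_sub _ _).trans ?_
      rw [abs_mul, abs_of_nonneg hR]
      nlinarith [hs k]
    rw [hZ2]
    nlinarith [he k, mul_le_mul_of_nonneg_left h5 (he k).le, sq_nonneg (e k), sq_nonneg R]
  calc s k * (e k * d k) * Z - (s k * e k + N) * (e k * d k)
      = d k * (e k * (s k * R - N)) := by rw [hZ2]; ring
    _ ≤ |d k| * |e k * (s k * R - N)| := by rw [← abs_mul]; exact le_abs_self _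
    _ ≤ |d k| * Z ^ 2 := mul_le_mul_of_nonneg_left h4 (abs_nonneg _)

/-- The softmax map is an ℓ1-contraction:
`‖softmax(u) − softmax(u')‖₁ ≤ ‖u − u'‖₁`. -/
theorem stmt10 (n : ℕ) (hn : 1 ≤ n) (u u' : Fin n → ℝ) :
    ∑ i, |Real.exp (u i) / (∑ k, Real.exp (u k)) -
          Real.exp (u' i) / (∑ k, Real.exp (u' k))| ≤
      ∑ i, |u i - u' i| := by
  have : Nonempty (Fin n) := ⟨⟨0, hn⟩⟩
  have hpos : ∀ v : Fin n → ℝ, 0 < ∑ k, Real.exp (v k) := fun v =>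
    Finset.sum_pos (fun i _ => Real.exp_pos _) Finset.univ_nonempty
  have hsg : ∀ x : ℝ, ∃ s : ℝ, |s| ≤ 1 ∧ |x| = s * x := by
    intro x
    rcases le_total 0 x with h | h
    · exact ⟨1, by simp, by simp [abs_of_nonneg h]⟩
    · exact ⟨-1, by simp, by simp [abs_of_nonpos h]⟩
  choose sg hsg1 hsg2 using hsg
  set s : Fin n → ℝ := fun i => sg (Real.exp (u i) / (∑ k, Real.exp (u k)) -
          Real.exp (u' i) / (∑ k, Real.exp (u' k))) with hs
  let d : Fin n → ℝ := fun i => u i - u' i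
  let φ : ℝ → ℝ := fun t => (∑ i, s i * Real.exp (u' i + t * d i)) /
    (∑ k, Real.exp (u' k + t * d k))
  have hE : ∀ (t : ℝ) (i : Fin n), HasDerivAt (fun t => Real.exp (u' i + t * d i))
      (Real.exp (u' i + t * d i) * d i) t := by
    intro t i
    have := (((hasDerivAt_id t).mul_const (d i)).const_add (u' i)).exp
    simpa using this
  have hφ : ∀ t, HasDerivAt φ _ t := fun t =>
    (HasDerivAt.fun_sum (u := Finset.univ) fun i _ => (hE t i).const_mul (s i)).fun_div
      (HasDerivAt.fun_sum (u := Finset.univ) fun i _ => hE t i)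
      (hpos fun k => u' k + t * d k).ne'
  obtain ⟨c, -, hc⟩ := exists_hasDerivAt_eq_slope φ _ (zero_lt_one)
    (fun t _ => (hφ t).continuousAt.continuousWithinAt) (fun t _ => hφ t)
  have hb := softmax_aux n (fun i => Real.exp (u' i + c * d i)) s d (fun i => Real.exp_pos _)
    (fun i => hsg1 _) (hpos _)
  have hL : ∑ i, |Real.exp (u i) / (∑ k, Real.exp (u k)) -
          Real.exp (u' i) / (∑ k, Real.exp (u' k))| = φ 1 - φ 0 := by
    simp only [φ, d, one_mul, zero_mul, add_zero, add_sub_cancel]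
    rw [Finset.sum_div, Finset.sum_div, ← Finset.sum_sub_distrib]
    refine Finset.sum_congr rfl fun i _ => ?_
    rw [hsg2, mul_div_assoc, mul_div_assoc, ← mul_sub]
  rw [hL]
  have h1 : φ 1 - φ 0 = (φ 1 - φ 0) / (1 - 0) := by simp
  rw [h1, ← hc]
  exact hb
end

section
/- Let n, m ≥ 1 and let s, s̃, s', s̃' ∈ ℝ^{n×m}. Define z_{ij} = min{ e^{s_{ij}} / Σ_{k=1}^m e^{s_{ik}}, e^{s̃_{ij}} / Σ_{k=1}^n e^{s̃_{kj}} } and z'_{ij} analogously from s', s̃'. Then Σ_{i,j} |z_{ij} − z'_{ij}| ≤ Σ_{i,j} |s_{ij} − s'_{ij}| + Σ_{i,j} |s̃_{ij} − s̃'_{ij}|. That is, the unit-demand min-of-two-softmax allocation layer is 1-Lipschitz from the ℓ1-norm on its score inputs to the ℓ1-norm on its output. -/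
lemma aux_ineq (a b a' b' D : ℝ) (ha : 0 ≤ a) (hb : 0 ≤ b) (ha' : 0 ≤ a') (hb' : 0 ≤ b')
    (hS : 0 < a + b) (hS' : 0 < a' + b') (hD : 0 ≤ D) (h : a * b' ≤ Real.exp D * (a' * b)) :
    a / (a + b) - a' / (a' + b') - (b / (a + b) - b' / (a' + b')) ≤ D := by
  have e1 : a / (a + b) - a' / (a' + b') - (b / (a + b) - b' / (a' + b'))
      = 2 * (a * b' - a' * b) / ((a + b) * (a' + b')) := by
    field_simp
    ring
  rw [e1, div_le_iff₀ (by positivity)]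
  obtain ⟨u, hu0, hu⟩ : ∃ u : ℝ, 0 ≤ u ∧ u ^ 2 = a * b' :=
    ⟨_, Real.sqrt_nonneg _, Real.sq_sqrt (by positivity)⟩
  obtain ⟨v, hv0, hv⟩ : ∃ v : ℝ, 0 ≤ v ∧ v ^ 2 = a' * b :=
    ⟨_, Real.sqrt_nonneg _, Real.sq_sqrt (by positivity)⟩
  have huv : u ≤ Real.exp (D / 2) * v := by
    refine (sq_le_sq₀ (by positivity) (by positivity)).1 ?_
    have e : Real.exp (D / 2) ^ 2 = Real.exp D := by
      rw [sq, ← Real.exp_add, add_halves]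
    rw [mul_pow, hu, hv, e]
    exact h
  have hE : Real.exp (-(D / 2)) * u ≤ v := by
    calc Real.exp (-(D / 2)) * u ≤ Real.exp (-(D / 2)) * (Real.exp (D / 2) * v) := by gcongr
      _ = v := by rw [← mul_assoc, ← Real.exp_add]; simp
  have hE2 : (-(D / 2) + 1) * u ≤ Real.exp (-(D / 2)) * u :=
    mul_le_mul_of_nonneg_right (Real.add_one_le_exp _) hu0
  have h1 : 2 * (u - v) ≤ D * (u + v) := by nlinarith [mul_nonneg hD hv0]
  have h2 : 2 * (u * v) ≤ a * a' + b * b' := by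
    refine (sq_le_sq₀ (by positivity) (by positivity)).1 ?_
    rw [mul_pow, mul_pow, hu, hv]
    nlinarith [sq_nonneg (a * a' - b * b')]
  have h3 : (u + v) ^ 2 ≤ (a + b) * (a' + b') := by nlinarith
  have h4 := mul_le_mul_of_nonneg_right h1 (add_nonneg hu0 hv0)
  have h5 := mul_le_mul_of_nonneg_left h3 hD
  nlinarith

lemma softmax_l1 {ι : Type*} [Fintype ι] [Nonempty ι] (x y : ι → ℝ) :
    ∑ j, |Real.exp (x j) / ∑ k, Real.exp (x k) - Real.exp (y j) / ∑ k, Real.exp (y k)|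
      ≤ ∑ j, |x j - y j| := by
  classical
  set S := ∑ k, Real.exp (x k) with hSd
  set T := ∑ k, Real.exp (y k) with hTd
  have hS : 0 < S := Finset.sum_pos (fun i _ => Real.exp_pos _) Finset.univ_nonempty
  have hT : 0 < T := Finset.sum_pos (fun i _ => Real.exp_pos _) Finset.univ_nonempty
  set P : ι → Prop := fun j => 0 ≤ Real.exp (x j) / S - Real.exp (y j) / T with hP
  have sx := Finset.sum_filter_add_sum_filter_not Finset.univ P (fun k => Real.exp (x k))
  have sy := Finset.sum_filter_add_sum_filter_not Finset.univ P (fun k => Real.exp (y k))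
  rw [← hSd] at sx
  rw [← hTd] at sy
  rw [← Finset.sum_filter_add_sum_filter_not Finset.univ P]
  have e1 : ∑ j with P j, |Real.exp (x j) / S - Real.exp (y j) / T|
      = (∑ j with P j, Real.exp (x j)) / S - (∑ j with P j, Real.exp (y j)) / T := by
    rw [Finset.sum_div, Finset.sum_div, ← Finset.sum_sub_distrib]
    refine Finset.sum_congr rfl fun j hj => abs_of_nonneg (Finset.mem_filter.1 hj).2
  have e2 : ∑ j with ¬ P j, |Real.exp (x j) / S - Real.exp (y j) / T|
      = -((∑ j with ¬ P j, Real.exp (x j)) / S - (∑ j with ¬ P j, Real.exp (y j)) / T) := by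
    rw [Finset.sum_div, Finset.sum_div, ← Finset.sum_sub_distrib, ← Finset.sum_neg_distrib]
    refine Finset.sum_congr rfl fun j hj => abs_of_neg (not_le.1 (Finset.mem_filter.1 hj).2)
  rw [e1, e2, ← sub_eq_add_neg]
  have hD : 0 ≤ ∑ j, |x j - y j| := Finset.sum_nonneg fun _ _ => abs_nonneg _
  have key : (∑ j with P j, Real.exp (x j)) * (∑ j with ¬ P j, Real.exp (y j)) ≤
      Real.exp (∑ j, |x j - y j|) *
        ((∑ j with P j, Real.exp (y j)) * (∑ j with ¬ P j, Real.exp (x j))) := by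
    rw [Finset.sum_mul_sum, Finset.sum_mul_sum, Finset.mul_sum]
    refine Finset.sum_le_sum fun i hi => ?_
    rw [Finset.mul_sum]
    refine Finset.sum_le_sum fun k hk => ?_
    rw [← Real.exp_add, ← Real.exp_add, ← Real.exp_add, Real.exp_le_exp]
    have hik : i ≠ k := by
      rintro rfl
      exact (Finset.mem_filter.1 hk).2 (Finset.mem_filter.1 hi).2
    have := Finset.sum_le_sum_of_subset_of_nonneg (f := fun j => |x j - y j|)
      (Finset.subset_univ {i, k}) (fun _ _ _ => abs_nonneg _)
    rw [Finset.sum_pair hik] at this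
    have h1 := le_abs_self (x i - y i)
    have h2 := neg_abs_le (x k - y k)
    linarith
  have := aux_ineq _ _ _ _ _ (Finset.sum_nonneg fun _ _ => (Real.exp_pos _).le)
    (Finset.sum_nonneg fun _ _ => (Real.exp_pos _).le)
    (Finset.sum_nonneg fun _ _ => (Real.exp_pos _).le)
    (Finset.sum_nonneg fun _ _ => (Real.exp_pos _).le)
    (by rw [sx]; exact hS) (by rw [sy]; exact hT) hD key
  rwa [sx, sy] at this


/-- The unit-demand min-of-two-softmax allocation layer is 1-Lipschitz from
the ℓ1-norm on its score inputs to the ℓ1-norm on its output: here `s i ·`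
is normalized by a softmax over items for each bidder `i`, and `t · j` is
normalized by a softmax over bidders for each item `j`. -/
theorem stmt11 (n m : ℕ) (hn : 1 ≤ n) (hm : 1 ≤ m)
    (s t s' t' : Fin n → Fin m → ℝ)
    (z z' : Fin n → Fin m → ℝ)
    (hz : ∀ i j, z i j =
      min (Real.exp (s i j) / ∑ k, Real.exp (s i k))
          (Real.exp (t i j) / ∑ k, Real.exp (t k j)))
    (hz' : ∀ i j, z' i j =
      min (Real.exp (s' i j) / ∑ k, Real.exp (s' i k))
          (Real.exp (t' i j) / ∑ k, Real.exp (t' k j))) :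
    ∑ i, ∑ j, |z i j - z' i j| ≤
      (∑ i, ∑ j, |s i j - s' i j|) + ∑ i, ∑ j, |t i j - t' i j| := by
  have : Nonempty (Fin n) := ⟨⟨0, hn⟩⟩
  have : Nonempty (Fin m) := ⟨⟨0, hm⟩⟩
  have h1 : ∀ i j, |z i j - z' i j| ≤
      |Real.exp (s i j) / ∑ k, Real.exp (s i k) - Real.exp (s' i j) / ∑ k, Real.exp (s' i k)| +
      |Real.exp (t i j) / ∑ k, Real.exp (t k j) - Real.exp (t' i j) / ∑ k, Real.exp (t' k j)| := by
    intro i j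
    rw [hz, hz']
    exact (abs_min_sub_min_le_max _ _ _ _).trans
      (max_le_add_of_nonneg (abs_nonneg _) (abs_nonneg _))
  refine (Finset.sum_le_sum fun i _ => Finset.sum_le_sum fun j _ => h1 i j).trans ?_
  simp only [Finset.sum_add_distrib]
  refine add_le_add (Finset.sum_le_sum fun i _ => softmax_l1 (s i) (s' i)) ?_
  rw [Finset.sum_comm, Finset.sum_comm (f := fun i j => |t i j - t' i j|)]
  exact Finset.sum_le_sum fun j _ => softmax_l1 (fun i => t i j) (fun i => t' i j)
end

section
/- Let n, m ≥ 1, let M = [m], and let s, s^{(1)}, …, s^{(m)} and s', s'^{(1)}, …, s'^{(m)} be families of scores in ℝ^{n × 2^m} indexed by bidders i ∈ [n] and bundles S ⊆ M. Define z_{i,S} = min{ softmax_S(s_{i,S'} : S'⊆M), softmax_S(s^{(1)}_{i,S'} : S'⊆M), …, softmax_S(s^{(m)}_{i,S'} : S'⊆M) }, where softmax_S(a_{S'} : S'⊆M) = exp(a_S)/Σ_{S'⊆M} exp(a_{S'}), and define z' analogously from the primed scores. Then Σ_{i,S} |z_{i,S} − z'_{i,S}| ≤ Σ_{i,S} |s_{i,S}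 − s'_{i,S}| + Σ_{j=1}^m Σ_{i,S} |s^{(j)}_{i,S} − s'^{(j)}_{i,S}|. -/
/-- Softmax over bundles: `smB a S = exp (a S) / Σ_{S'} exp (a S')`. -/
noncomputable def smB {m : ℕ} (a : Finset (Fin m) → ℝ) (S : Finset (Fin m)) : ℝ :=
  Real.exp (a S) / ∑ S' : Finset (Fin m), Real.exp (a S')

theorem smB_aux_real (X Y X' Y' r : ℝ) (hX : 0 ≤ X) (hY : 0 ≤ Y) (hX' : 0 ≤ X') (hY' : 0 ≤ Y')
    (hr : 1 ≤ r) (h : X' * Y ≤ r ^ 2 * (X * Y')) (hZ : 0 < X + Y) (hZ' : 0 < X' + Y') :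
    X' / (X' + Y') - X / (X + Y) ≤ 1 - 1 / r := by
  have hr0 : 0 < r := by linarith
  have ha : 0 ≤ X' * Y := by positivity
  have hb : 0 ≤ X * Y' := by positivity
  have hw : 0 ≤ X * X' + Y * Y' := by positivity
  have h1 : 2 * (X' * Y) ≤ r * (X * X' + Y * Y') := by
    refine (sq_le_sq₀ (by positivity) (by positivity)).mp ?_
    · have h2 : (X' * Y) * (X' * Y) ≤ (X' * Y) * (r ^ 2 * (X * Y')) :=
        mul_le_mul_of_nonneg_left h ha
      have h3 : 0 ≤ r ^ 2 * (X * X' - Y * Y') ^ 2 := by positivity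
      nlinarith
  generalize hα : X' * Y = α at *
  generalize hβ : X * Y' = β at *
  generalize hω : X * X' + Y * Y' = ω at *
  have e : X' / (X' + Y') - X / (X + Y) = (α - β) / (α + β + ω) := by
    have : α + β + ω = (X' + Y') * (X + Y) := by rw [← hα, ← hβ, ← hω]; ring
    rw [this, ← hα, ← hβ]
    field_simp
    ring
  have hp : 0 < α + β + ω := by
    have : α + β + ω = (X' + Y') * (X + Y) := by rw [← hα, ← hβ, ← hω]; ring
    rw [this]; positivity
  rw [e, div_le_iff₀ hp]
  have e2 : 1 - 1 / r = (r - 1) / r := by field_simp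
  rw [e2, div_mul_eq_mul_div, le_div_iff₀ hr0]
  have h4 : (r - 1) * (2 * α) ≤ (r - 1) * (r * ω) := mul_le_mul_of_nonneg_left h1 (by linarith)
  -- multiply through by `r`
  have h5 : r * ((α - β) * r) ≤ r * ((r - 1) * (α + β + ω)) := by
    have h6 : α ≤ r ^ 2 * β := h
    have h7 : 0 ≤ (r - 1) * α := mul_nonneg (by linarith) ha
    have h8 : 0 ≤ r * (r - 1) * β := mul_nonneg (mul_nonneg hr0.le (by linarith)) hb
    nlinarith
  exact le_of_mul_le_mul_left h5 hr0

theorem smB_sum_one {m : ℕ} (a : Finset (Fin m) → ℝ) : ∑ S, smB a S = 1 := by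
  unfold smB
  rw [← Finset.sum_div]
  exact div_self (Finset.sum_pos (fun _ _ => Real.exp_pos _) Finset.univ_nonempty).ne'

theorem smB_contract {m : ℕ} (a b : Finset (Fin m) → ℝ) :
    ∑ S, |smB a S - smB b S| ≤ ∑ S, |a S - b S| := by
  classical
  set A : Finset (Finset (Fin m)) := Finset.univ.filter (fun S => smB b S ≤ smB a S) with hA
  have hsplit : ∀ f : Finset (Fin m) → ℝ, ∑ S, f S = ∑ S ∈ A, f S + ∑ S ∈ Aᶜ, f S :=
    fun f => (Finset.sum_add_sum_compl A f).symm
  have e1 : ∑ S ∈ A, |smB a S - smB b S| = ∑ S ∈ A, smB a S - ∑ S ∈ A, smB b S := by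
    rw [← Finset.sum_sub_distrib]
    refine Finset.sum_congr rfl fun S hS => abs_of_nonneg ?_
    have := (Finset.mem_filter.mp hS).2
    linarith
  have e2 : ∑ S ∈ Aᶜ, |smB a S - smB b S| = ∑ S ∈ Aᶜ, smB b S - ∑ S ∈ Aᶜ, smB a S := by
    rw [← Finset.sum_sub_distrib]
    refine Finset.sum_congr rfl fun S hS => ?_
    have : ¬ smB b S ≤ smB a S := by simpa [hA] using hS
    rw [abs_of_nonpos (by linarith)]; ring
  have sa := smB_sum_one a
  have sb := smB_sum_one b
  rw [hsplit] at sa sb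
  have u1 : ∀ c : Finset (Fin m) → ℝ, ∑ S ∈ A, smB c S =
      (∑ S ∈ A, Real.exp (c S)) / (∑ S ∈ A, Real.exp (c S) + ∑ S ∈ Aᶜ, Real.exp (c S)) := by
    intro c
    rw [← hsplit (fun S => Real.exp (c S)), Finset.sum_div]
    rfl
  have pos : ∀ c : Finset (Fin m) → ℝ,
      0 < ∑ S ∈ A, Real.exp (c S) + ∑ S ∈ Aᶜ, Real.exp (c S) := by
    intro c
    rw [← hsplit (fun S => Real.exp (c S))]
    exact Finset.sum_pos (fun _ _ => Real.exp_pos _) Finset.univ_nonempty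
  have nn : ∀ (B : Finset (Finset (Fin m))) (c : Finset (Fin m) → ℝ),
      0 ≤ ∑ S ∈ B, Real.exp (c S) := fun B c => Finset.sum_nonneg fun _ _ => (Real.exp_pos _).le
  have key : ∀ (B : Finset (Finset (Fin m))) (c d : Finset (Fin m) → ℝ),
      ∑ S ∈ B, Real.exp (c S) ≤ Real.exp (∑ S ∈ B, |c S - d S|) * ∑ S ∈ B, Real.exp (d S) := by
    intro B c d
    rw [Finset.mul_sum]
    refine Finset.sum_le_sum fun S hS => ?_
    rw [← Real.exp_add]
    apply Real.exp_le_exp.mpr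
    have h1 := Finset.single_le_sum (f := fun S => |c S - d S|) (fun _ _ => abs_nonneg _) hS
    have h2 := le_abs_self (c S - d S)
    linarith
  have L0 : 0 ≤ ∑ S, |a S - b S| := Finset.sum_nonneg fun _ _ => abs_nonneg _
  have main := smB_aux_real (∑ S ∈ A, Real.exp (b S)) (∑ S ∈ Aᶜ, Real.exp (b S))
    (∑ S ∈ A, Real.exp (a S)) (∑ S ∈ Aᶜ, Real.exp (a S)) (Real.exp ((∑ S, |a S - b S|) / 2))
    (nn _ _) (nn _ _) (nn _ _) (nn _ _) (Real.one_le_exp (by linarith)) (by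
      have k1 := key A a b
      have k2 := key Aᶜ b a
      have k3 := mul_le_mul k1 k2 (nn _ _) (mul_nonneg (Real.exp_pos _).le (nn _ _))
      refine k3.trans (le_of_eq ?_)
      have e3 : ∑ S ∈ Aᶜ, |b S - a S| = ∑ S ∈ Aᶜ, |a S - b S| :=
        Finset.sum_congr rfl fun S _ => abs_sub_comm _ _
      have e4 : Real.exp ((∑ S, |a S - b S|) / 2) ^ 2 =
          Real.exp (∑ S ∈ A, |a S - b S|) * Real.exp (∑ S ∈ Aᶜ, |a S - b S|) := by
        rw [← Real.exp_add, ← hsplit (fun S => |a S - b S|), sq, ← Real.exp_add]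
        congr 1; ring
      rw [e3, e4]; ring) (pos b) (pos a)
  rw [← u1, ← u1, one_div, ← Real.exp_neg] at main
  have h9 := Real.add_one_le_exp (-((∑ S, |a S - b S|) / 2))
  rw [hsplit (fun S => |smB a S - smB b S|), e1, e2]
  linarith

theorem inf_aux {ι : Type*} [Fintype ι] (h : (Finset.univ : Finset ι).Nonempty) (f g : ι → ℝ)
    (x y : ℝ) :
    min x (Finset.univ.inf' h f) - min y (Finset.univ.inf' h g) ≤
      |x - y| + ∑ j, |f j - g j| := by
  have h0 : 0 ≤ ∑ j, |f j - g j| := Finset.sum_nonneg fun _ _ => abs_nonneg _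
  rcases min_choice y (Finset.univ.inf' h g) with e | e
  · rw [e]
    have := min_le_left x (Finset.univ.inf' h f)
    have := le_abs_self (x - y)
    linarith
  · rw [e]
    obtain ⟨j, -, hj⟩ := Finset.exists_mem_eq_inf' h g
    rw [hj]
    have h1 := min_le_right x (Finset.univ.inf' h f)
    have h2 := Finset.inf'_le f (Finset.mem_univ j)
    have h3 := Finset.single_le_sum (f := fun j => |f j - g j|) (fun _ _ => abs_nonneg _)
      (Finset.mem_univ j)
    have h4 := le_abs_self (f j - g j)
    have h5 := abs_nonneg (x - y)
    linarith

/-- ℓ1-Lipschitz bound for the output layer of the combinatorial allocation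
network: for each bidder `i`, the allocation of bundle `S` is the minimum of
the `m+1` softmax-normalized score vectors (one bidder-wise, one per item),
and the layer is 1-Lipschitz from the ℓ1-norm on scores to the ℓ1-norm on
allocations. -/
theorem stmt12 (n m : ℕ) (hn : 1 ≤ n) (hm : 1 ≤ m)
    (s s' : Fin n → Finset (Fin m) → ℝ)
    (sI sI' : Fin m → Fin n → Finset (Fin m) → ℝ)
    (z z' : Fin n → Finset (Fin m) → ℝ)
    (hz : ∀ i S, z i S =
      min (smB (s i) S)
        (Finset.univ.inf' (Finset.univ_nonempty_iff.mpr (Fin.pos_iff_nonempty.mp hm))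
          fun j => smB (sI j i) S))
    (hz' : ∀ i S, z' i S =
      min (smB (s' i) S)
        (Finset.univ.inf' (Finset.univ_nonempty_iff.mpr (Fin.pos_iff_nonempty.mp hm))
          fun j => smB (sI' j i) S)) :
    ∑ i, ∑ S : Finset (Fin m), |z i S - z' i S| ≤
      (∑ i, ∑ S : Finset (Fin m), |s i S - s' i S|) +
        ∑ j, ∑ i, ∑ S : Finset (Fin m), |sI j i S - sI' j i S| := by
  have pt : ∀ i S, |z i S - z' i S| ≤
      |smB (s i) S - smB (s' i) S| + ∑ j, |smB (sI j i) S - smB (sI' j i) S| := by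
    intro i S
    rw [hz, hz', abs_sub_le_iff]
    refine ⟨inf_aux _ _ _ _ _, (inf_aux _ _ _ _ _).trans (le_of_eq ?_)⟩
    rw [abs_sub_comm]
    congr 1
    exact Finset.sum_congr rfl fun j _ => abs_sub_comm _ _
  rw [Finset.sum_comm (s := (Finset.univ : Finset (Fin m))), ← Finset.sum_add_distrib]
  refine Finset.sum_le_sum fun i _ => ?_
  refine (Finset.sum_le_sum fun S _ => pt i S).trans ?_
  rw [Finset.sum_add_distrib, Finset.sum_comm (t := (Finset.univ : Finset (Fin m)))]
  exact add_le_add (smB_contract _ _) (Finset.sum_le_sum fun j _ => smB_contract _ _)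
end

section
/- Fix a bidder i with misreport space V_i = [0,1]^D, let V = V_1 × ⋯ × V_n, and let 𝓛 > 0 and 0 < ε ≤ 2𝓛. Let U_i be a class of functions u : V_i × V → ℝ, each continuous in the misreport argument, that satisfy |u(v_i, (v'_i, v_{−i})) − u(v_i, (v''_i, v_{−i}))| ≤ 𝓛‖v'_i − v''_i‖_∞ for all v ∈ V, v'_i, v''_i ∈ V_i. Let Û_i ⊆ U_i be a finite set such that every u ∈ U_i has some û ∈ Û_i with sup_{v∈V, v'_i∈V_i} |u(v_i,(v'_i,v_{−i})) − û(v_i,(v'_i,v_{−i}))| ≤ ε/4. Fix v ∈ V and let X_1, …, X_Q be i.i.d. uniform on [0,1]^D. Then the probability that sup_{u∈U_i} | max_{q∈[Q]} u(v_i, (X_q, v_{−i})) − max_{v'_i∈V_i} u(v_i, (v'_i, v_{−i})) | ≥ ε is at most |Û_i| · exp(−Q·(ε/(2𝓛))^D). -/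
open MeasureTheory

/-- The uniform probability measure on the cube `[0,1]^D`. -/
noncomputable def unifCube (D : ℕ) : Measure (Fin D → ℝ) :=
  Measure.pi fun _ => volume.restrict (Set.Icc (0 : ℝ) 1)


instance probI : IsProbabilityMeasure (volume.restrict (Set.Icc (0 : ℝ) 1)) :=
  ⟨by simp⟩

instance probCube (D : ℕ) : IsProbabilityMeasure (unifCube D) := by
  unfold unifCube; infer_instance

lemma one_dim (x r : ℝ) (hx : x ∈ Set.Icc (0 : ℝ) 1) (hr : 0 < r) (hr1 : r ≤ 1) :
    ENNReal.ofReal r ≤ (volume.restrict (Set.Icc (0 : ℝ) 1)) (Metric.ball x r) := by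
  rw [Measure.restrict_apply measurableSet_ball]
  have hsub : Set.Ioo (max (x - r) 0) (min (x + r) 1) ⊆ Metric.ball x r ∩ Set.Icc 0 1 := by
    rintro y ⟨h1, h2⟩
    rw [max_lt_iff] at h1
    rw [lt_min_iff] at h2
    rw [Real.ball_eq_Ioo]
    exact ⟨⟨h1.1, h2.1⟩, h1.2.le, h2.2.le⟩
  refine le_trans ?_ (measure_mono hsub)
  rw [Real.volume_Ioo]
  apply ENNReal.ofReal_le_ofReal
  obtain ⟨h0, h1⟩ := hx
  rcases max_cases (x - r) 0 with h | h <;> rcases min_cases (x + r) 1 with h' | h' <;>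
    linarith [h.1, h'.1]

lemma cube_ball (D : ℕ) (x : Fin D → ℝ) (r : ℝ) (hx : x ∈ Set.Icc (0 : Fin D → ℝ) 1)
    (hr : 0 < r) (hr1 : r ≤ 1) :
    ENNReal.ofReal (r ^ D) ≤ unifCube D (Metric.ball x r) := by
  rw [ball_pi x hr, unifCube, Measure.pi_pi, ENNReal.ofReal_pow hr.le]
  calc ENNReal.ofReal r ^ D = ∏ _j : Fin D, ENNReal.ofReal r := by simp
    _ ≤ _ := Finset.prod_le_prod' fun j _ => one_dim (x j) r ⟨hx.1 j, hx.2 j⟩ hr hr1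

lemma miss_bound (D Q : ℕ) (x : Fin D → ℝ) (r : ℝ) (hx : x ∈ Set.Icc (0 : Fin D → ℝ) 1)
    (hr : 0 < r) (hr1 : r ≤ 1) :
    (Measure.pi fun _ : Fin Q => unifCube D)
      (Set.univ.pi fun _ : Fin Q => (Metric.ball x r)ᶜ) ≤
      ENNReal.ofReal (Real.exp (-(Q : ℝ) * r ^ D)) := by
  rw [Measure.pi_pi, Finset.prod_const, Finset.card_univ, Fintype.card_fin,
    prob_compl_eq_one_sub measurableSet_ball]
  have h1 : 1 - unifCube D (Metric.ball x r) ≤ ENNReal.ofReal (Real.exp (-(r ^ D))) := by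
    refine (tsub_le_tsub_left (cube_ball D x r hx hr hr1) 1).trans ?_
    rw [← ENNReal.ofReal_one, ← ENNReal.ofReal_sub _ (by positivity)]
    apply ENNReal.ofReal_le_ofReal
    linarith [Real.add_one_le_exp (-(r ^ D))]
  calc _ ≤ ENNReal.ofReal (Real.exp (-(r ^ D))) ^ Q := by gcongr
    _ = _ := by
      rw [← ENNReal.ofReal_pow (Real.exp_pos _).le, ← Real.exp_nat_mul]
      congr 2; ring

lemma ae_cube (D : ℕ) : ∀ᵐ x ∂(unifCube D), x ∈ Set.Icc (0 : Fin D → ℝ) 1 := by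
  have h : ∀ j : Fin D, ∀ᵐ x ∂(unifCube D), x j ∈ Set.Icc (0 : ℝ) 1 := fun j =>
    (Measure.quasiMeasurePreserving_eval
      (fun _ : Fin D => volume.restrict (Set.Icc (0 : ℝ) 1)) j).ae
      (ae_restrict_mem measurableSet_Icc)
  filter_upwards [ae_all_iff.2 h] with x hx
  exact ⟨fun j => (hx j).1, fun j => (hx j).2⟩

lemma ae_cubes (D Q : ℕ) : ∀ᵐ X ∂(Measure.pi fun _ : Fin Q => unifCube D),
    ∀ q, X q ∈ Set.Icc (0 : Fin D → ℝ) 1 :=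
  ae_all_iff.2 fun q =>
    (Measure.quasiMeasurePreserving_eval (fun _ : Fin Q => unifCube D) q).ae (ae_cube D)

/-- Single-profile concentration lemma for the sample-based approximation of
the maximum misreport utility: for a fixed valuation profile `v`, with `Q`
i.i.d. uniform misreports, the probability that for some utility function in
the class the sampled maximum misreport utility differs from the true maximum
by at least `ε` is at most `|Û| · exp(−Q (ε/(2𝓛))^D)`. -/
theorem stmt14 (n D Q : ℕ) (hQ : 0 < Q) (i : Fin n)
    (V : Fin n → Set (Fin D → ℝ))
    (hVi : V i = Set.Icc (0 : Fin D → ℝ) 1)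
    (lip ε : ℝ) (hlip0 : 0 < lip) (hε : 0 < ε) (hε2 : ε ≤ 2 * lip)
    (U : Set ((Fin D → ℝ) → (Fin n → Fin D → ℝ) → ℝ))
    (hcont : ∀ u ∈ U, ∀ (vi : Fin D → ℝ) (b : Fin n → Fin D → ℝ),
      ContinuousOn (fun v' => u vi (Function.update b i v')) (V i))
    (hlip : ∀ u ∈ U, ∀ w : Fin n → Fin D → ℝ, (∀ j, w j ∈ V j) →
      ∀ a ∈ V i, ∀ a' ∈ V i,
        |u (w i) (Function.update w i a) - u (w i) (Function.update w i a')| ≤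
          lip * ‖a - a'‖)
    (Uh : Finset ((Fin D → ℝ) → (Fin n → Fin D → ℝ) → ℝ))
    (hUhU : ∀ uh ∈ Uh, uh ∈ U)
    (hcover : ∀ u ∈ U, ∃ uh ∈ Uh, ∀ w : Fin n → Fin D → ℝ, (∀ j, w j ∈ V j) →
      ∀ a ∈ V i,
        |u (w i) (Function.update w i a) - uh (w i) (Function.update w i a)| ≤ ε / 4)
    (v : Fin n → Fin D → ℝ) (hv : ∀ j, v j ∈ V j) :
    (Measure.pi fun _ : Fin Q => unifCube D)
      {X : Fin Q → Fin D → ℝ | ∃ u ∈ U,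
        ε ≤ |(Finset.univ.sup'
                (Finset.univ_nonempty_iff.mpr (Fin.pos_iff_nonempty.mp hQ))
                fun q => u (v i) (Function.update v i (X q))) -
              sSup ((fun v' => u (v i) (Function.update v i v')) '' V i)|} ≤
      ENNReal.ofReal ((Uh.card : ℝ) * Real.exp (-(Q : ℝ) * (ε / (2 * lip)) ^ D)) := by
  have hcpt : IsCompact (V i) := by rw [hVi]; exact isCompact_Icc
  have hne : (V i).Nonempty := ⟨v i, hv i⟩
  have hmax : ∀ u, ∃ x ∈ V i, u ∈ U → ∀ y ∈ V i,
      u (v i) (Function.update v i y) ≤ u (v i) (Function.update v i x) := by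
    intro u
    by_cases hu : u ∈ U
    · obtain ⟨x, hx, hm⟩ := hcpt.exists_isMaxOn hne (hcont u hu (v i) v)
      exact ⟨x, hx, fun _ y hy => hm hy⟩
    · exact ⟨v i, hv i, fun h => absurd h hu⟩
  choose xs hxs hxmax using hmax
  have hr : 0 < ε / (2 * lip) := by positivity
  have hr1 : ε / (2 * lip) ≤ 1 := by rw [div_le_one (by positivity)]; exact hε2
  have hsub : {X : Fin Q → Fin D → ℝ | ∃ u ∈ U,
        ε ≤ |(Finset.univ.sup'
                (Finset.univ_nonempty_iff.mpr (Fin.pos_iff_nonempty.mp hQ))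
                fun q => u (v i) (Function.update v i (X q))) -
              sSup ((fun v' => u (v i) (Function.update v i v')) '' V i)|}
      ≤ᵐ[Measure.pi fun _ : Fin Q => unifCube D]
      (⋃ uh ∈ Uh, Set.univ.pi fun _ : Fin Q => (Metric.ball (xs uh) (ε / (2 * lip)))ᶜ :
        Set (Fin Q → Fin D → ℝ)) := by
    filter_upwards [ae_cubes D Q] with X hX hbad
    obtain ⟨u, hu, hbad⟩ := hbad
    obtain ⟨uh, huh, hc⟩ := hcover u hu
    have hXV : ∀ q, X q ∈ V i := fun q => by rw [hVi]; exact hX q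
    have hgr : IsGreatest ((fun v' => u (v i) (Function.update v i v')) '' V i)
        (u (v i) (Function.update v i (xs u))) := by
      refine ⟨⟨xs u, hxs u, rfl⟩, ?_⟩
      rintro _ ⟨y, hy, rfl⟩
      exact hxmax u hu y hy
    rw [hgr.csSup_eq, abs_sub_comm, abs_of_nonneg (by
      rw [sub_nonneg]
      exact Finset.sup'_le _ _ fun q _ => hxmax u hu _ (hXV q))] at hbad
    refine Set.mem_biUnion (x := uh) huh ?_
    intro q _ hq
    rw [Metric.mem_ball, dist_eq_norm] at hq
    have h1 := Finset.le_sup' (fun q => u (v i) (Function.update v i (X q)))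
      (Finset.mem_univ q)
    have h2 := abs_le.1 (hc v hv (X q) (hXV q))
    have h3 := abs_le.1 (hc v hv (xs u) (hxs u))
    have h4 := hxmax uh (hUhU uh huh) (xs u) (hxs u)
    have h5 := abs_le.1 (hlip uh (hUhU uh huh) v hv (X q) (hXV q) (xs uh) (hxs uh))
    have h6 : lip * ‖X q - xs uh‖ < ε / 2 := by
      calc _ < lip * (ε / (2 * lip)) := by gcongr
        _ = ε / 2 := by field_simp
    linarith [h2.1, h2.2, h3.1, h3.2, h5.1, h5.2]
  refine (measure_mono_ae hsub).trans ((measure_biUnion_finset_le _ _).trans ?_)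
  calc _ ≤ ∑ _uh ∈ Uh, ENNReal.ofReal (Real.exp (-(Q : ℝ) * (ε / (2 * lip)) ^ D)) :=
        Finset.sum_le_sum fun uh _ =>
          miss_bound D Q (xs uh) _ (by rw [← hVi]; exact hxs uh) hr hr1
    _ = _ := by
      rw [Finset.sum_const, nsmul_eq_mul, ENNReal.ofReal_mul (by positivity),
        ENNReal.ofReal_natCast]
end

section
/- There exists a universal constant C > 0 with the following property. Let n, m ≥ 1, let each V_i be a compact subset of [0,1]^{2^m}, V = V_1 × ⋯ × V_n, let F be a probability distribution on V, and let M be any class of individually rational auctions (g,p) with Σ_{S⊆M} g_{i,S}(b) ≤ 1 for all i, b (all relevant functions measurable). For every δ ∈ (0,1) and L ≥ 1, with probability at least 1 − δ over an i.i.d. sample v^{(1)}, …, v^{(L)} from F, every auction (g,p) ∈ M satisfies E_{v∼F}[ −Σ_{i=1}^n p_i(v) ] ≤ −(1/L) Σ_{ℓ=1}^L Σ_{i=1}^n p_i(v^{(ℓ)}) + 2nΔ_L + Cn√(log(1/δ)/L), where Δ_L = inf_{ε>0, N_∞(M,ε/2)<∞} ( ε/n + 2√( 2 log N_∞(M, ε/2)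 / L ) ). -/
open MeasureTheory

/-- An auction for `n` bidders and `m` items: an allocation rule assigning to
each bid profile a probability for each bidder–bundle pair, and a payment
rule assigning a payment to each bidder. -/
abbrev Auction (n m : ℕ) :=
  ((Fin n → Finset (Fin m) → ℝ) → Fin n → Finset (Fin m) → ℝ) ×
    ((Fin n → Finset (Fin m) → ℝ) → Fin n → ℝ)

/-- The `ℓ_{∞,1}` discrepancy of two auctions at a valuation profile `v`. -/
noncomputable def auctionDistAt (n m : ℕ) (a a' : Auction n m)
    (v : Fin n → Finset (Fin m) → ℝ) : ℝ :=
  (∑ i, ∑ S : Finset (Fin m), |a.1 v i S - a'.1 v i S|) + ∑ i, |a.2 v i - a'.2 v i|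

/-- The covering number `N_∞(M, ε)` of a class of auctions under the
`ℓ_{∞,1}` distance over valuation profiles in `Vset`: the minimum cardinality
of a finite set of auctions such that every auction in `M` is within
distance `ε` of a member, or `⊤` if no finite cover exists. -/
noncomputable def coverNum (n m : ℕ) (Vset : Set (Fin n → Finset (Fin m) → ℝ))
    (M : Set (Auction n m)) (ε : ℝ) : ℕ∞ :=
  ⨅ (C : Finset (Auction n m))
    (_ : ∀ a ∈ M, ∃ c ∈ C, ∀ v ∈ Vset, auctionDistAt n m a c v ≤ ε),
    (C.card : ℕ∞)

/-- The generalization-gap term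
`Δ_L = inf_{ε>0, N_∞(M,ε/2)<∞} ( ε/n + 2 √(2 log N_∞(M, ε/2) / L) )`. -/
noncomputable def DeltaL (n m L : ℕ) (Vset : Set (Fin n → Finset (Fin m) → ℝ))
    (M : Set (Auction n m)) : ℝ :=
  sInf {t : ℝ | ∃ ε : ℝ, 0 < ε ∧ coverNum n m Vset M (ε / 2) ≠ ⊤ ∧
    t = ε / (n : ℝ) +
      2 * Real.sqrt (2 * Real.log (((coverNum n m Vset M (ε / 2)).toNat : ℝ)) / (L : ℝ))}

theorem hoeff_aux {Ω : Type*} [MeasurableSpace Ω] (F : Measure Ω) [IsProbabilityMeasure F]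
    (f : Ω → ℝ) (hf : Measurable f) (B : ℝ) (hB : 0 < B) (hb : ∀ᵐ x ∂F, f x ∈ Set.Icc 0 B)
    (L : ℕ) (hL : 1 ≤ L) (t : ℝ) (ht : 0 ≤ t) :
    (Measure.pi fun _ : Fin L => F).real {ω | L * t ≤ ∑ ℓ, (f (ω ℓ) - ∫ x, f x ∂F)}
      ≤ Real.exp (-(2 * L * t ^ 2 / B ^ 2)) := by
  have hL' : (0 : ℝ) < L := by exact_mod_cast hL
  have hind : ProbabilityTheory.iIndepFun
      (fun (ℓ : Fin L) (ω : Fin L → Ω) => f (ω ℓ) - ∫ x, f x ∂F) (Measure.pi fun _ : Fin L => F) :=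
    ProbabilityTheory.iIndepFun_pi (X := fun _ x => f x - ∫ x, f x ∂F)
      (fun _ => (hf.sub_const _).aemeasurable)
  have hsub : ∀ ℓ ∈ (Finset.univ : Finset (Fin L)), ProbabilityTheory.HasSubgaussianMGF
      (fun (ω : Fin L → Ω) => f (ω ℓ) - ∫ x, f x ∂F) ((‖B - 0‖₊ / 2) ^ 2)
      (Measure.pi fun _ : Fin L => F) := by
    intro ℓ _
    have h := ProbabilityTheory.hasSubgaussianMGF_of_mem_Icc
      (μ := Measure.pi fun _ : Fin L => F) (X := fun ω => f (ω ℓ)) (a := 0) (b := B)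
      (hf.comp (measurable_pi_apply ℓ)).aemeasurable
      ((Measure.tendsto_eval_ae_ae (μ := fun _ : Fin L => F) (i := ℓ)).eventually hb)
    rwa [integral_comp_eval (μ := fun _ : Fin L => F) (i := ℓ) hf.aestronglyMeasurable] at h
  have h := ProbabilityTheory.HasSubgaussianMGF.measure_sum_ge_le_of_iIndepFun hind hsub
    (ε := L * t) (by positivity)
  refine h.trans (le_of_eq ?_)
  congr 1
  have : ((‖B - 0‖₊ : NNReal) : ℝ) = B := by simp [abs_of_pos hB]
  push_cast
  simp only [Finset.sum_const, Finset.card_univ, Fintype.card_fin, nsmul_eq_mul]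
  rw [coe_nnnorm] at this
  rw [this]
  field_simp

theorem finite_class_aux {Ω ι : Type*} [MeasurableSpace Ω] (F : Measure Ω) [IsProbabilityMeasure F]
    (V : Set Ω) (hVm : MeasurableSet V) (hV : F V = 1)
    (s : Finset ι) (hs : s.Nonempty)
    (f : ι → Ω → ℝ) (hf : ∀ k, Measurable (f k)) (B : ℝ) (hB : 0 < B)
    (hb : ∀ k, ∀ x ∈ V, f k x ∈ Set.Icc 0 B)
    (L : ℕ) (hL : 1 ≤ L) (δ : ℝ) (hδ : δ ∈ Set.Ioo (0 : ℝ) 1) :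
    ∃ E : Set (Fin L → Ω), MeasurableSet E ∧
      ENNReal.ofReal (1 - δ) ≤ (Measure.pi fun _ : Fin L => F) E ∧
      ∀ ω ∈ E, (∀ ℓ, ω ℓ ∈ V) ∧ ∀ k ∈ s,
        ∑ ℓ, f k (ω ℓ) ≤ L * (∫ x, f k x ∂F) +
          L * (B * Real.sqrt (Real.log (s.card / δ) / (2 * L))) := by
  have hL' : (0 : ℝ) < L := by exact_mod_cast hL
  have hc : (1 : ℝ) ≤ s.card := by exact_mod_cast hs.card_pos
  obtain ⟨hδ0, hδ1⟩ := hδ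
  set t := B * Real.sqrt (Real.log (s.card / δ) / (2 * L)) with ht
  have ht0 : 0 ≤ t := by positivity
  have hlog : 0 ≤ Real.log (s.card / δ) := by
    apply Real.log_nonneg
    rw [le_div_iff₀ hδ0]; linarith
  have hVae : ∀ᵐ x ∂F, x ∈ V := (prob_compl_eq_zero_iff hVm).2 hV
  set P := Measure.pi fun _ : Fin L => F with hP
  let bad : ι → Set (Fin L → Ω) := fun k => {ω | L * t ≤ ∑ ℓ, (f k (ω ℓ) - ∫ x, f k x ∂F)}
  have hbadm : ∀ k, MeasurableSet (bad k) := by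
    intro k
    apply measurableSet_le measurable_const
    exact Finset.measurable_fun_sum _ fun ℓ _ => ((hf k).comp (measurable_pi_apply ℓ)).sub_const _
  have hbad : ∀ k, P.real (bad k) ≤ δ / s.card := by
    intro k
    refine (hoeff_aux F (f k) (hf k) B hB (hVae.mono (hb k)) L hL t ht0).trans (le_of_eq ?_)
    have : 2 * L * t ^ 2 / B ^ 2 = Real.log (s.card / δ) := by
      rw [ht, mul_pow, Real.sq_sqrt (by positivity)]
      field_simp
    rw [this, Real.exp_neg, Real.exp_log (by positivity), inv_div]
  let W : Set (Fin L → Ω) := {ω | ∀ ℓ, ω ℓ ∈ V}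
  have hWm : MeasurableSet W := by
    have : W = ⋂ ℓ, (fun ω : Fin L → Ω => ω ℓ) ⁻¹' V := by ext; simp [W]
    rw [this]
    exact MeasurableSet.iInter fun ℓ => measurable_pi_apply ℓ hVm
  have hW : P Wᶜ = 0 := by
    have : ∀ᵐ ω ∂P, ∀ ℓ, ω ℓ ∈ V :=
      Filter.eventually_all.2 fun ℓ => Measure.tendsto_eval_ae_ae.eventually hVae
    exact this
  have hUm : MeasurableSet (⋃ k ∈ s, bad k) := Finset.measurableSet_biUnion _ fun k _ => hbadm k
  refine ⟨(Wᶜ ∪ ⋃ k ∈ s, bad k)ᶜ, (hWm.compl.union hUm).compl, ?_, ?_⟩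
  · have h1 : P.real (Wᶜ ∪ ⋃ k ∈ s, bad k) ≤ δ := by
      refine (measureReal_union_le _ _).trans ?_
      have : P.real Wᶜ = 0 := by simp [Measure.real, hW]
      rw [this, zero_add]
      refine (measureReal_biUnion_finset_le _ _).trans ?_
      refine (Finset.sum_le_sum fun k _ => hbad k).trans (le_of_eq ?_)
      simp only [Finset.sum_const, nsmul_eq_mul]
      field_simp
    rw [← ofReal_measureReal]
    apply ENNReal.ofReal_le_ofReal
    rw [probReal_compl_eq_one_sub (hWm.compl.union hUm)]
    linarith
  · intro ω hω
    simp only [Set.compl_union, compl_compl, Set.mem_inter_iff, Set.mem_compl_iff, Set.mem_iUnion,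
      not_exists] at hω
    refine ⟨hω.1, fun k hk => ?_⟩
    have h := hω.2 k hk
    simp only [bad, Set.mem_ofPred_eq, not_le, Finset.sum_sub_distrib, Finset.sum_const,
      Finset.card_univ, Fintype.card_fin, nsmul_eq_mul] at h
    linarith

theorem coverNum_attained (n m : ℕ) (Vset : Set (Fin n → Finset (Fin m) → ℝ))
    (M : Set (Auction n m)) (ε : ℝ) (h : coverNum n m Vset M ε ≠ ⊤) :
    ∃ C : Finset (Auction n m),
      (∀ a ∈ M, ∃ c ∈ C, ∀ v ∈ Vset, auctionDistAt n m a c v ≤ ε) ∧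
      (coverNum n m Vset M ε).toNat = C.card := by
  unfold coverNum at h ⊢
  rw [iInf_subtype'] at h ⊢
  have : Nonempty {C : Finset (Auction n m) //
      ∀ a ∈ M, ∃ c ∈ C, ∀ v ∈ Vset, auctionDistAt n m a c v ≤ ε} := by
    by_contra hne
    rw [not_nonempty_iff] at hne
    exact h (iInf_of_empty _)
  obtain ⟨C, hC⟩ := ENat.exists_eq_iInf (fun C : {C : Finset (Auction n m) //
      ∀ a ∈ M, ∃ c ∈ C, ∀ v ∈ Vset, auctionDistAt n m a c v ≤ ε} => (C.1.card : ℕ∞))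
  exact ⟨C, C.2, by rw [← hC]; simp⟩

theorem pay_dist (n m : ℕ) (a b c : Auction n m) (v : Fin n → Finset (Fin m) → ℝ) (ε : ℝ)
    (ha : auctionDistAt n m a c v ≤ ε / 2) (hb : auctionDistAt n m b c v ≤ ε / 2) :
    |∑ i, a.2 v i - ∑ i, b.2 v i| ≤ ε := by
  have key : ∀ a : Auction n m, auctionDistAt n m a c v ≤ ε / 2 →
      |∑ i, a.2 v i - ∑ i, c.2 v i| ≤ ε / 2 := by
    intro a ha
    unfold auctionDistAt at ha
    rw [← Finset.sum_sub_distrib]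
    refine (Finset.abs_sum_le_sum_abs _ _).trans ?_
    have : 0 ≤ ∑ i, ∑ S : Finset (Fin m), |a.1 v i S - c.1 v i S| := by positivity
    linarith
  have h1 := abs_le.1 (key a ha)
  have h2 := abs_le.1 (key b hb)
  rw [abs_le]
  constructor <;> linarith [h1.1, h1.2, h2.1, h2.2]

/-- Generalization bound for revenue: with probability at least `1 − δ` over
an i.i.d. sample of `L` valuation profiles from `F`, for every individually
rational auction in the class `M`, the expected negated revenue is at most
the empirical negated revenue plus `2 n Δ_L + C n √(log(1/δ)/L)`. -/
theorem stmt16 :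
    ∃ C : ℝ, 0 < C ∧
      ∀ (n m : ℕ), 1 ≤ n → 1 ≤ m →
      ∀ Vi : Fin n → Set (Finset (Fin m) → ℝ),
        (∀ i, IsCompact (Vi i)) →
        (∀ i, ∀ x ∈ Vi i, ∀ S : Finset (Fin m), x S ∈ Set.Icc (0 : ℝ) 1) →
      ∀ F : Measure (Fin n → Finset (Fin m) → ℝ), IsProbabilityMeasure F →
        F {v | ∀ i, v i ∈ Vi i} = 1 →
      ∀ M : Set (Auction n m),
        (∀ a ∈ M, ∀ v ∈ {v : Fin n → Finset (Fin m) → ℝ | ∀ i, v i ∈ Vi i}, ∀ i,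
          (∀ S : Finset (Fin m), 0 ≤ a.1 v i S) ∧
          (∑ S : Finset (Fin m), a.1 v i S) ≤ 1 ∧
          0 ≤ a.2 v i ∧
          a.2 v i ≤ ∑ S : Finset (Fin m), v i S * a.1 v i S) →
        (∀ a ∈ M, ∀ i : Fin n,
          Measurable (fun v => a.2 v i) ∧
          ∀ S : Finset (Fin m), Measurable (fun v => a.1 v i S)) →
        (∃ ε : ℝ, 0 < ε ∧
          coverNum n m {v | ∀ i, v i ∈ Vi i} M (ε / 2) ≠ ⊤) →
      ∀ δ : ℝ, δ ∈ Set.Ioo (0 : ℝ) 1 →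
      ∀ L : ℕ, 1 ≤ L →
      ∃ E : Set (Fin L → (Fin n → Finset (Fin m) → ℝ)),
        MeasurableSet E ∧
        ENNReal.ofReal (1 - δ) ≤ (Measure.pi fun _ : Fin L => F) E ∧
        ∀ ω ∈ E, ∀ a ∈ M,
          (∫ v, (-(∑ i, a.2 v i)) ∂F) ≤
            -((1 / (L : ℝ)) * ∑ ℓ : Fin L, ∑ i, a.2 (ω ℓ) i) +
              2 * (n : ℝ) * DeltaL n m L {v | ∀ i, v i ∈ Vi i} M +
              C * (n : ℝ) * Real.sqrt (Real.log (1 / δ) / (L : ℝ)) := by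
  refine ⟨2, by norm_num, ?_⟩
  intro n m hn hm Vi hVc hV01 F hF hFV M hIR hmeas hcov δ hδ L hL
  set V : Set (Fin n → Finset (Fin m) → ℝ) := {v | ∀ i, v i ∈ Vi i} with hVdef
  have hn' : (0 : ℝ) < n := by exact_mod_cast hn
  have hL' : (0 : ℝ) < L := by exact_mod_cast hL
  rcases M.eq_empty_or_nonempty with hM | ⟨a₀, ha₀⟩
  · refine ⟨Set.univ, MeasurableSet.univ, ?_, ?_⟩
    · rw [measure_univ]
      exact ENNReal.ofReal_le_one.2 (by linarith [hδ.1])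
    · intro ω _ a ha
      simp [hM] at ha
  have hVm : MeasurableSet V := by
    have : V = ⋂ i, (fun v : Fin n → Finset (Fin m) → ℝ => v i) ⁻¹' Vi i := by ext; simp [V]
    rw [this]
    exact MeasurableSet.iInter fun i => measurable_pi_apply i (hVc i).measurableSet
  have hVae : ∀ᵐ x ∂F, x ∈ V := (prob_compl_eq_zero_iff hVm).2 hFV
  -- revenue bounds
  have hrev : ∀ a ∈ M, ∀ v ∈ V, ∑ i, a.2 v i ∈ Set.Icc (0 : ℝ) n := by
    intro a ha v hv
    refine ⟨Finset.sum_nonneg fun i _ => (hIR a ha v hv i).2.2.1, ?_⟩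
    have : ∀ i, a.2 v i ≤ 1 := by
      intro i
      obtain ⟨h1, h2, h3, h4⟩ := hIR a ha v hv i
      refine h4.trans (le_trans (Finset.sum_le_sum fun S _ => ?_) h2)
      exact mul_le_of_le_one_left (h1 S) (hV01 i (v i) (hv i) S).2
    calc ∑ i, a.2 v i ≤ ∑ _i : Fin n, (1 : ℝ) := Finset.sum_le_sum fun i _ => this i
      _ = n := by simp
  have hrevm : ∀ a ∈ M, Measurable fun v => ∑ i, a.2 v i := fun a ha =>
    Finset.measurable_fun_sum _ fun i _ => (hmeas a ha i).1
  have hint : ∀ a ∈ M, Integrable (fun v => ∑ i, a.2 v i) F := fun a ha =>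
    Integrable.of_mem_Icc 0 n (hrevm a ha).aemeasurable (hVae.mono (hrev a ha))
  -- choose ε
  set r := Real.sqrt (Real.log (1 / δ) / L) with hr
  have hlogδ : 0 < Real.log (1 / δ) := Real.log_pos (by
    rw [lt_div_iff₀ hδ.1]; linarith [hδ.2])
  have hrpos : 0 < r := Real.sqrt_pos.2 (by positivity)
  obtain ⟨ε, hε, hfin, hεle⟩ : ∃ ε : ℝ, 0 < ε ∧ coverNum n m V M (ε / 2) ≠ ⊤ ∧
      ε / (n : ℝ) + 2 * Real.sqrt (2 * Real.log (((coverNum n m V M (ε / 2)).toNat : ℝ)) / (L : ℝ))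
        < DeltaL n m L V M + r / 2 := by
    have hne : {t : ℝ | ∃ ε : ℝ, 0 < ε ∧ coverNum n m V M (ε / 2) ≠ ⊤ ∧
      t = ε / (n : ℝ) + 2 * Real.sqrt
        (2 * Real.log (((coverNum n m V M (ε / 2)).toNat : ℝ)) / (L : ℝ))}.Nonempty := by
      obtain ⟨ε, h1, h2⟩ := hcov
      exact ⟨_, ε, h1, h2, rfl⟩
    obtain ⟨t, ⟨ε, h1, h2, h3⟩, h4⟩ := exists_lt_of_csInf_lt hne
      (b := DeltaL n m L V M + r / 2) (by unfold DeltaL; linarith)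
    exact ⟨ε, h1, h2, h3 ▸ h4⟩
  obtain ⟨K, hK, hKcard⟩ := coverNum_attained n m V M (ε / 2) hfin
  rw [hKcard] at hεle
  have hKne : K.Nonempty := by
    obtain ⟨c, hc, _⟩ := hK a₀ ha₀
    exact ⟨c, hc⟩
  -- representatives
  have hrep : ∀ c : Auction n m, ∃ b ∈ M,
      (∃ a ∈ M, ∀ v ∈ V, auctionDistAt n m a c v ≤ ε / 2) →
        ∀ v ∈ V, auctionDistAt n m b c v ≤ ε / 2 := by
    intro c
    by_cases h : ∃ a ∈ M, ∀ v ∈ V, auctionDistAt n m a c v ≤ ε / 2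
    · obtain ⟨a, ha, hac⟩ := h
      exact ⟨a, ha, fun _ => hac⟩
    · exact ⟨a₀, ha₀, fun h' => absurd h' h⟩
  choose rep hrepM hrepd using hrep
  obtain ⟨E, hEm, hEp, hE⟩ := finite_class_aux F V hVm hFV K hKne
    (fun c v => ∑ i, (rep c).2 v i) (fun c => hrevm _ (hrepM c)) n hn'
    (fun c => hrev _ (hrepM c)) L hL δ hδ
  refine ⟨E, hEm, hEp, ?_⟩
  intro ω hω a ha
  obtain ⟨hωV, hωK⟩ := hE ω hω
  obtain ⟨c, hcK, hac⟩ := hK a ha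
  have hbc := hrepd c ⟨a, ha, hac⟩
  have hdist : ∀ v ∈ V, |∑ i, a.2 v i - ∑ i, (rep c).2 v i| ≤ ε := fun v hv =>
    pay_dist n m a (rep c) c v ε (hac v hv) (hbc v hv)
  have hmain := hωK c hcK
  have hI : ∫ v, ∑ i, (rep c).2 v i ∂F ≤ (∫ v, ∑ i, a.2 v i ∂F) + ε := by
    have h1 : ∫ v, ∑ i, (rep c).2 v i ∂F ≤ ∫ v, (∑ i, a.2 v i + ε) ∂F := by
      apply integral_mono_ae (hint _ (hrepM c)) ((hint a ha).add (integrable_const ε))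
      filter_upwards [hVae] with v hv
      have := (abs_le.1 (hdist v hv)).1
      change ∑ i, (rep c).2 v i ≤ ∑ i, a.2 v i + ε
      linarith
    rw [integral_add (hint a ha) (integrable_const ε)] at h1
    simpa using h1
  have hS : ∑ ℓ, ∑ i, a.2 (ω ℓ) i ≤ ∑ ℓ, ∑ i, (rep c).2 (ω ℓ) i + L * ε := by
    calc ∑ ℓ, ∑ i, a.2 (ω ℓ) i ≤ ∑ ℓ, (∑ i, (rep c).2 (ω ℓ) i + ε) :=
          Finset.sum_le_sum fun ℓ _ => by
            have := (abs_le.1 (hdist (ω ℓ) (hωV ℓ))).2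
            linarith
      _ = _ := by simp [Finset.sum_add_distrib]
  -- square root bounds
  have hc1 : (1 : ℝ) ≤ K.card := by exact_mod_cast hKne.card_pos
  have hlogK : 0 ≤ Real.log K.card := Real.log_nonneg hc1
  set q := Real.sqrt (2 * Real.log (K.card : ℝ) / (L : ℝ)) with hq
  have hq0 : 0 ≤ q := Real.sqrt_nonneg _
  have hsq : Real.sqrt (Real.log (K.card / δ) / (2 * L)) ≤ q + r := by
    apply Real.sqrt_le_iff.2
    refine ⟨by positivity, ?_⟩
    have hq2 : q ^ 2 = 2 * Real.log (K.card : ℝ) / (L : ℝ) := Real.sq_sqrt (by positivity)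
    have hr2 : r ^ 2 = Real.log (1 / δ) / (L : ℝ) := Real.sq_sqrt (by positivity)
    have : Real.log (K.card / δ) / (2 * L) = q ^ 2 / 4 + r ^ 2 / 2 := by
      rw [hq2, hr2, Real.log_div (by positivity) hδ.1.ne', one_div, Real.log_inv]
      field_simp
      ring
    rw [this]
    nlinarith [mul_nonneg hq0 hrpos.le, sq_nonneg q, sq_nonneg r]
  have hn1 : n * Real.sqrt (Real.log (K.card / δ) / (2 * L)) ≤ n * (q + r) := by gcongr
  rw [integral_neg]
  have hfinal : (1 / (L : ℝ)) * ∑ ℓ : Fin L, ∑ i, a.2 (ω ℓ) i ≤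
      (∫ v, ∑ i, a.2 v i ∂F) + 2 * ε + n * (q + r) := by
    rw [one_div, inv_mul_le_iff₀ hL']
    have h1 := mul_le_mul_of_nonneg_left hI hL'.le
    have h2 := mul_le_mul_of_nonneg_left hn1 hL'.le
    linarith
  have hD : 2 * ε + 4 * n * q ≤ 2 * n * DeltaL n m L V M + n * r := by
    have h := mul_le_mul_of_nonneg_left hεle.le (by positivity : (0 : ℝ) ≤ 2 * n)
    have h' : 2 * (n : ℝ) * (ε / n + 2 * q) = 2 * ε + 4 * n * q := by
      field_simp
      ring
    linarith
  have hnq : 0 ≤ n * q := by positivity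
  linarith
end

section
/- There exists a universal constant C > 0 with the following property. Let n, m ≥ 1, V_i = [0,1]^{D_i} with D = max_i D_i, V = V_1 × ⋯ × V_n, let F be a probability distribution on V, and let 𝓛 > 0. Let M be a class of individually rational auctions (g,p) with Σ_S g_{i,S}(b) ≤ 1, whose rules satisfy, for all i, v'_i, v''_i ∈ V_i and v_{−i}: ‖g_i(v'_i, v_{−i}) − g_i(v''_i, v_{−i})‖_1 ≤ 𝓛‖v'_i − v''_i‖_∞ and |p_i(v'_i, v_{−i}) − p_i(v''_i, v_{−i})| ≤ 𝓛‖v'_i − v''_i‖_∞ (all relevant functions measurable). For δ ∈ (0,1), with probability at least 1 − δ over an i.i.d. sample v^{(1)}, …, v^{(L)} from F together with, for each bidder i and each ℓ, an independent sample S_i^{(ℓ)} of Q i.i.d. uniform misreports from V_i, every (g,p) ∈ M and every bidder i satisfy rgt_i(g,p) − r̃gt_i(g,p) ≤ 2Δ̃_L + C√(log(n/δ)/L), where r̃gt_i(g,p) = (1/L)Σ_ℓ [ max_{v'_i ∈ S_i^{(ℓ)}} u_i(v_i^{(ℓ)}, (v'_i, v_{−i}^{(ℓ)})) − u_i(v_i^{(ℓ)},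 v^{(ℓ)}) ] and Δ̃_L = inf_{ε>0} ( ε + 2√(2 log N_∞(M, ε/2)/L) + 2𝓛·( log(2nL·N_∞(M, ε/4)/δ) / Q )^{1/D} ). -/
open MeasureTheory

/-- The profile space when bidder `i`'s valuations/bids live in `ℝ^{Di i}`. -/
abbrev Profile (n : ℕ) (Di : Fin n → ℕ) := ∀ i : Fin n, Fin (Di i) → ℝ

/-- An auction: an allocation rule and a payment rule on bid profiles. -/
abbrev Auction18 (n : ℕ) (Di : Fin n → ℕ) :=
  (Profile n Di → ∀ i : Fin n, Fin (Di i) → ℝ) × (Profile n Di → Fin n → ℝ)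

/-- The valuation space: each bidder's component in the unit cube. -/
def cubeProfiles (n : ℕ) (Di : Fin n → ℕ) : Set (Profile n Di) :=
  {v | ∀ i, v i ∈ Set.Icc (0 : Fin (Di i) → ℝ) 1}

/-- The `ℓ_{∞,1}` discrepancy of two auctions at a profile `v`. -/
noncomputable def auctionDistAt18 (n : ℕ) (Di : Fin n → ℕ)
    (a a' : Auction18 n Di) (v : Profile n Di) : ℝ :=
  (∑ i, ∑ k, |a.1 v i k - a'.1 v i k|) + ∑ i, |a.2 v i - a'.2 v i|

/-- The covering number `N_∞(M, ε)` of a class of auctions under the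
`ℓ_{∞,1}` distance over valuation profiles in the unit cubes. -/
noncomputable def coverNum18 (n : ℕ) (Di : Fin n → ℕ)
    (M : Set (Auction18 n Di)) (ε : ℝ) : ℕ∞ :=
  ⨅ (C : Finset (Auction18 n Di))
    (_ : ∀ a ∈ M, ∃ c ∈ C, ∀ v ∈ cubeProfiles n Di, auctionDistAt18 n Di a c v ≤ ε),
    (C.card : ℕ∞)

/-- The utility of bidder `i` with valuation profile `v` when misreporting `x`. -/
noncomputable def utilAt18 (n : ℕ) (Di : Fin n → ℕ) (a : Auction18 n Di)
    (v : Profile n Di) (i : Fin n) (x : Fin (Di i) → ℝ) : ℝ :=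
  (∑ k, v i k * a.1 (Function.update v i x) i k) - a.2 (Function.update v i x) i

/-- The term
`Δ̃_L = inf_{ε>0} ( ε + 2 √(2 log N_∞(M,ε/2)/L)
  + 2𝓛 ( log(2 n L N_∞(M,ε/4)/δ) / Q )^{1/D} )`,
the infimum ranging over `ε` for which the covering numbers are finite. -/
noncomputable def DeltaTilde (n : ℕ) (Di : Fin n → ℕ) (M : Set (Auction18 n Di))
    (L Q : ℕ) (lip δ : ℝ) : ℝ :=
  sInf {t : ℝ | ∃ ε : ℝ, 0 < ε ∧
    coverNum18 n Di M (ε / 2) ≠ ⊤ ∧ coverNum18 n Di M (ε / 4) ≠ ⊤ ∧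
    t = ε + 2 * Real.sqrt (2 * Real.log (((coverNum18 n Di M (ε / 2)).toNat : ℝ)) / (L : ℝ)) +
      2 * lip *
        (Real.log (2 * (n : ℝ) * (L : ℝ) * ((coverNum18 n Di M (ε / 4)).toNat : ℝ) / δ) /
            (Q : ℝ)) ^ ((1 : ℝ) / ((Finset.univ.sup Di : ℕ) : ℝ))}


/-- The uniform distribution on the cube. -/
noncomputable abbrev cubeM (d : ℕ) : Measure (Fin d → ℝ) :=
  Measure.pi fun _ : Fin d => volume.restrict (Set.Icc (0 : ℝ) 1)

instance instProbIcc01 : IsProbabilityMeasure ((volume : Measure ℝ).restrict (Set.Icc (0 : ℝ) 1)) :=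
  ⟨by simp⟩

lemma cubeM_ae (d : ℕ) : ∀ᵐ y ∂(cubeM d), y ∈ Set.Icc (0 : Fin d → ℝ) 1 := by
  have h : ∀ᵐ y ∂(cubeM d), ∀ k, y k ∈ Set.Icc (0 : ℝ) 1 := by
    rw [ae_all_iff]
    intro k
    exact (Measure.quasiMeasurePreserving_eval _ k).ae (ae_restrict_mem measurableSet_Icc)
  filter_upwards [h] with y hy
  exact ⟨fun k => (hy k).1, fun k => (hy k).2⟩

lemma cubeM_far (d : ℕ) (x : Fin d → ℝ) (hx : x ∈ Set.Icc (0 : Fin d → ℝ) 1) (t : ℝ)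
    (ht0 : 0 ≤ t) (ht1 : t ≤ 1) :
    (cubeM d).real {y | t < ‖y - x‖} ≤ 1 - t ^ d := by
  have hms : MeasurableSet {y : Fin d → ℝ | ‖y - x‖ ≤ t} :=
    measurableSet_le (by fun_prop) measurable_const
  have hc : {y : Fin d → ℝ | t < ‖y - x‖} = {y | ‖y - x‖ ≤ t}ᶜ := by
    ext y; simp
  rw [hc, probReal_compl_eq_one_sub hms]
  have hsub : Set.pi Set.univ (fun k => Set.Icc (min (x k) (1 - t)) (min (x k) (1 - t) + t)) ⊆
      {y : Fin d → ℝ | ‖y - x‖ ≤ t} := by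
    intro y hy
    simp only [Set.mem_ofPred_eq]
    rw [pi_norm_le_iff_of_nonneg ht0]
    intro k
    have h1 := hy k (Set.mem_univ k)
    have h2 := hx.2 k
    simp only [Pi.one_apply] at h2
    simp only [Set.mem_Icc] at h1
    rw [Pi.sub_apply, Real.norm_eq_abs, abs_le]
    rcases min_cases (x k) (1 - t) with h | h <;> constructor <;> linarith
  have hmeas : (cubeM d).real
      (Set.pi Set.univ (fun k => Set.Icc (min (x k) (1 - t)) (min (x k) (1 - t) + t))) = t ^ d := by
    rw [Measure.real, Measure.pi_pi, ENNReal.toReal_prod]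
    have : ∀ k : Fin d, ((volume : Measure ℝ).restrict (Set.Icc (0 : ℝ) 1)
        (Set.Icc (min (x k) (1 - t)) (min (x k) (1 - t) + t))).toReal = t := by
      intro k
      have h1 := hx.1 k
      simp only [Pi.zero_apply] at h1
      rw [Measure.restrict_apply measurableSet_Icc, Set.inter_eq_left.mpr]
      · simp [ht0]
      · apply Set.Icc_subset_Icc
        · exact le_min h1 (by linarith)
        · have := min_le_right (x k) (1 - t)
          linarith
    simp only [this, Finset.prod_const, Finset.card_univ, Fintype.card_fin]
  have := measureReal_mono (μ := cubeM d) hsub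
  linarith

/-- The misreport sample distribution. -/
noncomputable abbrev sampM (n : ℕ) (Di : Fin n → ℕ) (Q : ℕ) :
    Measure (∀ i : Fin n, Fin Q → (Fin (Di i) → ℝ)) :=
  Measure.pi fun i : Fin n => Measure.pi fun _ : Fin Q =>
              Measure.pi fun _ : Fin (Di i) => volume.restrict (Set.Icc (0 : ℝ) 1)

lemma sampM_ae (n : ℕ) (Di : Fin n → ℕ) (Q : ℕ) :
    ∀ᵐ s ∂(sampM n Di Q), ∀ i q, s i q ∈ Set.Icc (0 : Fin (Di i) → ℝ) 1 := by
  rw [ae_all_iff]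
  intro i
  rw [ae_all_iff]
  intro q
  have h1 := (Measure.quasiMeasurePreserving_eval (fun _ : Fin Q => cubeM (Di i)) q).ae
    (cubeM_ae (Di i))
  exact (Measure.quasiMeasurePreserving_eval
    (fun i : Fin n => Measure.pi fun _ : Fin Q => cubeM (Di i)) i).ae h1

lemma sampM_far (n : ℕ) (Di : Fin n → ℕ) (Q : ℕ) (i : Fin n) (x : Fin (Di i) → ℝ)
    (hx : x ∈ Set.Icc (0 : Fin (Di i) → ℝ) 1) (t : ℝ)
    (ht0 : 0 ≤ t) (ht1 : t ≤ 1) :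
    (sampM n Di Q).real {s | ∀ q, t < ‖s i q - x‖} ≤ (1 - t ^ (Di i)) ^ Q := by
  have hs : {s : ∀ i : Fin n, Fin Q → (Fin (Di i) → ℝ) | ∀ q, t < ‖s i q - x‖} =
      Function.eval i ⁻¹' (Set.pi Set.univ fun _ : Fin Q => {y | t < ‖y - x‖}) := by
    ext s; simp
  have hm : MeasurableSet {y : Fin (Di i) → ℝ | t < ‖y - x‖} :=
    measurableSet_lt measurable_const (by fun_prop)
  rw [hs, Measure.real, (measurePreserving_eval
    (fun i : Fin n => Measure.pi fun _ : Fin Q => cubeM (Di i)) i).measure_preimage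
      (MeasurableSet.univ_pi fun _ => hm).nullMeasurableSet, Measure.pi_pi, ENNReal.toReal_prod]
  simp only [Finset.prod_const, Finset.card_univ, Fintype.card_fin]
  exact pow_le_pow_left₀ ENNReal.toReal_nonneg (cubeM_far (Di i) x hx t ht0 ht1) Q

lemma sampM_tail (n : ℕ) (Di : Fin n → ℕ) (Q D : ℕ) (i : Fin n) (hD : Di i ≤ D) (hD1 : 1 ≤ D)
    (x : Fin (Di i) → ℝ)
    (hx : x ∈ Set.Icc (0 : Fin (Di i) → ℝ) 1) (r : ℝ) (hr : 0 < r)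
    (hrQ : Real.log 2 ≤ Q * r ^ D) (k : ℕ) (hk : k * r ≤ 1) :
    (sampM n Di Q).real {s | ∀ q, k * r < ‖s i q - x‖} ≤ (1 / 2) ^ k := by
  have h0 : 0 ≤ k * r := by positivity
  refine (sampM_far n Di Q i x hx _ h0 hk).trans ?_
  have h1 : (k * r) ^ D ≤ (k * r) ^ (Di i) := pow_le_pow_of_le_one h0 hk hD
  have h2 : 1 - (k * r) ^ (Di i) ≤ Real.exp (-(k * r) ^ D) := by
    have := Real.add_one_le_exp (-(k * r) ^ D)
    linarith
  have h3 : 0 ≤ 1 - (k * r) ^ (Di i) := by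
    have := pow_le_one₀ (n := Di i) h0 hk
    linarith
  refine (pow_le_pow_left₀ h3 h2 Q).trans ?_
  rw [← Real.exp_nat_mul]
  have h4 : ((1 : ℝ) / 2) ^ k = Real.exp (k * (-Real.log 2)) := by
    rw [Real.exp_nat_mul, Real.exp_neg, Real.exp_log (by norm_num)]; norm_num
  rw [h4, Real.exp_le_exp]
  have h5 : (k : ℝ) ≤ (k : ℝ) ^ D := by
    exact_mod_cast Nat.le_self_pow (by omega) k
  have h6 : (k : ℝ) * Real.log 2 ≤ (k : ℝ) ^ D * (Q * r ^ D) := by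
    apply mul_le_mul h5 hrQ (Real.log_nonneg (by norm_num)) (by positivity)
  rw [mul_pow]
  linarith

/-- abstract version: expected max over misreports. -/
lemma sampM_expect (n : ℕ) (Di : Fin n → ℕ) (Q D : ℕ) (hQ : 0 < Q) (i : Fin n)
    (hD : Di i ≤ D) (hD1 : 1 ≤ D)
    (x : Fin (Di i) → ℝ)
    (hx : x ∈ Set.Icc (0 : Fin (Di i) → ℝ) 1) (r : ℝ) (hr : 0 < r)
    (hrQ : Real.log 2 ≤ Q * r ^ D) (G : (∀ i : Fin n, Fin Q → (Fin (Di i) → ℝ)) → ℝ)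
    (hG : Integrable G (sampM n Di Q)) (c K : ℝ) (hK : 0 ≤ K)
    (hGc : ∀ s : (∀ i : Fin n, Fin Q → (Fin (Di i) → ℝ)),
      (∀ i q, s i q ∈ Set.Icc (0 : Fin (Di i) → ℝ) 1) →
      ∀ q, c - K * ‖s i q - x‖ ≤ G s) :
    c - 2 * K * r ≤ ∫ s, G s ∂(sampM n Di Q) := by
  set T := ⌈1 / r⌉₊ with hT
  have hTr : 1 ≤ T * r := by
    have := Nat.le_ceil (1 / r)
    rwa [div_le_iff₀ hr] at this
  have hkT : ∀ k < T, (k : ℝ) * r ≤ 1 := by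
    intro k hk
    have := Nat.lt_ceil.mp hk
    rw [lt_div_iff₀ hr] at this
    exact this.le
  let A : ℕ → Set (∀ i : Fin n, Fin Q → (Fin (Di i) → ℝ)) :=
    fun k => {s | ∀ q, k * r < ‖s i q - x‖}
  have hA : ∀ k, MeasurableSet (A k) := by
    intro k
    have : A k = ⋂ q, {s | k * r < ‖s i q - x‖} := by ext s; simp [A]
    rw [this]
    exact MeasurableSet.iInter fun q => measurableSet_lt measurable_const (by fun_prop)
  have hint : ∀ k, Integrable ((A k).indicator (fun _ => (1 : ℝ))) (sampM n Di Q) := fun k =>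
    (integrable_const _).indicator (hA k)
  have hpt : ∀ᵐ s ∂(sampM n Di Q),
      c - K * r * ∑ k ∈ Finset.range T, (A k).indicator (fun _ => (1 : ℝ)) s ≤ G s := by
    filter_upwards [sampM_ae n Di Q] with s hs
    have hex : ∃ k, s ∉ A k := by
      refine ⟨T, fun h => ?_⟩
      have h1 := h ⟨0, hQ⟩
      have h2 : ‖s i ⟨0, hQ⟩ - x‖ ≤ 1 := by
        rw [pi_norm_le_iff_of_nonneg zero_le_one]
        intro k
        have a1 := (hs i ⟨0, hQ⟩).1 k
        have a2 := (hs i ⟨0, hQ⟩).2 k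
        have a3 := hx.1 k
        have a4 := hx.2 k
        simp only [Pi.zero_apply, Pi.one_apply] at a1 a2 a3 a4
        rw [Pi.sub_apply, Real.norm_eq_abs, abs_le]
        constructor <;> linarith
      linarith
    classical
    have hk0 := Nat.find_spec hex
    have hmin : ∀ k < Nat.find hex, s ∈ A k := fun k hk => not_not.mp (Nat.find_min hex hk)
    have hle : Nat.find hex ≤ T := by
      by_contra hlt
      push Not at hlt
      have h1 := hmin T hlt ⟨0, hQ⟩
      have h2 : ‖s i ⟨0, hQ⟩ - x‖ ≤ 1 := by
        rw [pi_norm_le_iff_of_nonneg zero_le_one]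
        intro k
        have a1 := (hs i ⟨0, hQ⟩).1 k
        have a2 := (hs i ⟨0, hQ⟩).2 k
        have a3 := hx.1 k
        have a4 := hx.2 k
        simp only [Pi.zero_apply, Pi.one_apply] at a1 a2 a3 a4
        rw [Pi.sub_apply, Real.norm_eq_abs, abs_le]
        constructor <;> linarith
      linarith
    generalize Nat.find hex = k0 at hk0 hmin hle
    simp only [A, Set.mem_ofPred_eq, not_forall, not_lt] at hk0
    obtain ⟨q, hq⟩ := hk0
    have hsum : (k0 : ℝ) ≤ ∑ k ∈ Finset.range T, (A k).indicator (fun _ => (1 : ℝ)) s := by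
      calc (k0 : ℝ) = ∑ k ∈ Finset.range k0, (1 : ℝ) := by simp
        _ = ∑ k ∈ Finset.range k0, (A k).indicator (fun _ => (1 : ℝ)) s := by
            apply Finset.sum_congr rfl
            intro k hk
            rw [Set.indicator_of_mem (hmin k (Finset.mem_range.mp hk))]
        _ ≤ _ := by
            apply Finset.sum_le_sum_of_subset_of_nonneg
            · exact Finset.range_subset_range.mpr hle
            · intro k _ _
              exact Set.indicator_nonneg (fun _ _ => zero_le_one) _
    have h1 := hGc s hs q
    have h2 : K * ‖s i q - x‖ ≤ K * (k0 * r) := mul_le_mul_of_nonneg_left hq hK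
    have h3 : K * r * k0 ≤ K * r * ∑ k ∈ Finset.range T, (A k).indicator (fun _ => (1 : ℝ)) s :=
      mul_le_mul_of_nonneg_left hsum (by positivity)
    linarith [mul_assoc K r (k0 : ℝ), mul_comm r (k0 : ℝ)]
  have hI : ∫ s, (c - K * r * ∑ k ∈ Finset.range T, (A k).indicator (fun _ => (1 : ℝ)) s)
      ∂(sampM n Di Q) = c - K * r * ∑ k ∈ Finset.range T, (sampM n Di Q).real (A k) := by
    rw [integral_sub (integrable_const _) ((integrable_finsetSum _ fun k _ => hint k).const_mul _),
      integral_const_mul, integral_finsetSum _ fun k _ => hint k]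
    simp only [integral_indicator_const _ (hA _)]
    simp
  have hmono := integral_mono_ae ((integrable_const c).sub
    ((integrable_finsetSum (Finset.range T) fun k _ => hint k).const_mul (K * r))) hG hpt
  simp only [Pi.sub_apply] at hmono
  rw [hI] at hmono
  have hb : ∑ k ∈ Finset.range T, (sampM n Di Q).real (A k) ≤ 2 := by
    refine le_trans (Finset.sum_le_sum fun k hk => ?_) (sum_geometric_two_le T)
    exact sampM_tail n Di Q D i hD hD1 x hx r hr hrQ k (hkT k (Finset.mem_range.mp hk))
  have : K * r * ∑ k ∈ Finset.range T, (sampM n Di Q).real (A k) ≤ K * r * 2 :=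
    mul_le_mul_of_nonneg_left hb (by positivity)
  linarith

/-- One-sided Hoeffding. -/
lemma hoeff {Z : Type*} [MeasurableSpace Z] (μ : Measure Z) [IsProbabilityMeasure μ]
    (f : Z → ℝ) (hf : Measurable f) (hb : ∀ᵐ z ∂μ, f z ∈ Set.Icc (-2 : ℝ) 2)
    (L : ℕ) (hL : 1 ≤ L) (t : ℝ) (ht : 0 ≤ t) :
    (Measure.pi fun _ : Fin L => μ).real {ω | L * t ≤ ∑ l, ((∫ z, f z ∂μ) - f (ω l))} ≤
      Real.exp (-(L * t ^ 2) / 8) := by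
  have h4 : ((‖(2 : ℝ) - (-2)‖₊ / 2) ^ 2 : NNReal) = 4 := by
    apply NNReal.eq
    push_cast
    norm_num
  have hsub : ProbabilityTheory.HasSubgaussianMGF (fun z => (∫ z, f z ∂μ) - f z) 4 μ := by
    have h := (ProbabilityTheory.hasSubgaussianMGF_of_mem_Icc hf.aemeasurable hb).neg
    rw [h4] at h
    refine h.congr ?_
    filter_upwards with z
    simp
  have hind : ProbabilityTheory.iIndepFun
      (fun (l : Fin L) (ω : Fin L → Z) => (∫ z, f z ∂μ) - f (ω l))
      (Measure.pi fun _ : Fin L => μ) :=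
    ProbabilityTheory.iIndepFun_pi (X := fun _ z => (∫ z, f z ∂μ) - f z)
      (fun l => (measurable_const.sub hf).aemeasurable)
  have hs : ∀ l ∈ (Finset.univ : Finset (Fin L)), ProbabilityTheory.HasSubgaussianMGF
      (fun ω : Fin L → Z => (∫ z, f z ∂μ) - f (ω l)) 4
      (Measure.pi fun _ : Fin L => μ) := by
    intro l _
    have hm := (measurePreserving_eval (fun _ : Fin L => μ) l)
    have hsub' : ProbabilityTheory.HasSubgaussianMGF (fun z => (∫ z, f z ∂μ) - f z) 4
        ((Measure.pi fun _ : Fin L => μ).map (Function.eval l)) := by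
      rw [hm.map_eq]; exact hsub
    exact @ProbabilityTheory.HasSubgaussianMGF.of_map _ _ _ _ _ _ (Function.eval l)
      (fun z => (∫ z, f z ∂μ) - f z) hm.measurable.aemeasurable hsub'
  have h := ProbabilityTheory.HasSubgaussianMGF.measure_sum_ge_le_of_iIndepFun hind hs
    (ε := L * t) (by positivity)
  refine h.trans (le_of_eq ?_)
  congr 1
  have hL' : (L : ℝ) ≠ 0 := by positivity
  simp only [Finset.sum_const, Finset.card_univ, Fintype.card_fin, nsmul_eq_mul]
  push_cast
  field_simp
  ring

/-- Membership of an auction in the class considered: individually rational, feasible, Lipschitz and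
measurable. -/
structure GoodAuction (n : ℕ) (Di : Fin n → ℕ) (lip : ℝ) (a : Auction18 n Di) : Prop where
  ir : ∀ v ∈ cubeProfiles n Di, ∀ i,
          (∀ k, 0 ≤ a.1 v i k) ∧ (∑ k, a.1 v i k) ≤ 1 ∧
          0 ≤ a.2 v i ∧ a.2 v i ≤ ∑ k, v i k * a.1 v i k
  lipc : ∀ i : Fin n, ∀ b : Profile n Di, b ∈ cubeProfiles n Di →
          ∀ v' ∈ Set.Icc (0 : Fin (Di i) → ℝ) 1, ∀ v'' ∈ Set.Icc (0 : Fin (Di i) → ℝ) 1,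
            (∑ k, |a.1 (Function.update b i v') i k - a.1 (Function.update b i v'') i k| ≤
              lip * ‖v' - v''‖) ∧
            |a.2 (Function.update b i v') i - a.2 (Function.update b i v'') i| ≤
              lip * ‖v' - v''‖
  meas : ∀ i : Fin n, Measurable (fun v => a.2 v i) ∧ ∀ k, Measurable (fun v => a.1 v i k)

lemma update_mem_cube {n : ℕ} {Di : Fin n → ℕ} {v : Profile n Di} (hv : v ∈ cubeProfiles n Di)
    (i : Fin n) {x : Fin (Di i) → ℝ} (hx : x ∈ Set.Icc (0 : Fin (Di i) → ℝ) 1) :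
    Function.update v i x ∈ cubeProfiles n Di := by
  intro j
  by_cases h : j = i
  · subst h; simpa using hx
  · simpa [Function.update_of_ne h] using hv j

lemma dot_bound {d : ℕ} (v g : Fin d → ℝ) (hv : v ∈ Set.Icc (0 : Fin d → ℝ) 1)
    (hg : ∀ k, 0 ≤ g k) : 0 ≤ ∑ k, v k * g k ∧ ∑ k, v k * g k ≤ ∑ k, g k := by
  constructor
  · exact Finset.sum_nonneg fun k _ => mul_nonneg (hv.1 k) (hg k)
  · exact Finset.sum_le_sum fun k _ => mul_le_of_le_one_left (hg k) (hv.2 k)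

lemma dot_abs {d : ℕ} (v g h : Fin d → ℝ) (hv : v ∈ Set.Icc (0 : Fin d → ℝ) 1) :
    |∑ k, v k * g k - ∑ k, v k * h k| ≤ ∑ k, |g k - h k| := by
  rw [← Finset.sum_sub_distrib]
  refine (Finset.abs_sum_le_sum_abs _ _).trans (Finset.sum_le_sum fun k _ => ?_)
  rw [← mul_sub, abs_mul, abs_of_nonneg (hv.1 k)]
  exact mul_le_of_le_one_left (abs_nonneg _) (hv.2 k)

lemma util_truth (n : ℕ) (Di : Fin n → ℕ) (a : Auction18 n Di) (v : Profile n Di) (i : Fin n) :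
    (∑ k, v i k * a.1 v i k) - a.2 v i = utilAt18 n Di a v i (v i) := by
  simp [utilAt18]

lemma util_bound {n : ℕ} {Di : Fin n → ℕ} {lip : ℝ} {a : Auction18 n Di}
    (ha : GoodAuction n Di lip a) {v : Profile n Di} (hv : v ∈ cubeProfiles n Di) (i : Fin n)
    {x : Fin (Di i) → ℝ} (hx : x ∈ Set.Icc (0 : Fin (Di i) → ℝ) 1) :
    -1 ≤ utilAt18 n Di a v i x ∧ utilAt18 n Di a v i x ≤ 1 := by
  obtain ⟨h1, h2, h3, h4⟩ := ha.ir _ (update_mem_cube hv i hx) i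
  rw [Function.update_self] at h4
  have h5 := dot_bound x _ hx h1
  have h6 := dot_bound (v i) _ (hv i) h1
  unfold utilAt18
  constructor <;> linarith [h5.1, h5.2, h6.1, h6.2]

lemma truth_bound {n : ℕ} {Di : Fin n → ℕ} {lip : ℝ} {a : Auction18 n Di}
    (ha : GoodAuction n Di lip a) {v : Profile n Di} (hv : v ∈ cubeProfiles n Di) (i : Fin n) :
    0 ≤ utilAt18 n Di a v i (v i) := by
  rw [← util_truth]
  linarith [(ha.ir v hv i).2.2.2]

lemma util_lip {n : ℕ} {Di : Fin n → ℕ} {lip : ℝ} {a : Auction18 n Di}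
    (ha : GoodAuction n Di lip a) {v : Profile n Di} (hv : v ∈ cubeProfiles n Di) (i : Fin n)
    {x y : Fin (Di i) → ℝ} (hx : x ∈ Set.Icc (0 : Fin (Di i) → ℝ) 1)
    (hy : y ∈ Set.Icc (0 : Fin (Di i) → ℝ) 1) :
    utilAt18 n Di a v i x - 2 * lip * ‖y - x‖ ≤ utilAt18 n Di a v i y := by
  obtain ⟨h1, h2⟩ := ha.lipc i v hv y hy x hx
  have h3 := dot_abs (v i) (a.1 (Function.update v i y) i) (a.1 (Function.update v i x) i) (hv i)
  unfold utilAt18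
  have := abs_le.mp (h3.trans h1)
  have := abs_le.mp h2
  linarith [this.1, this.2]

lemma util_dist {n : ℕ} {Di : Fin n → ℕ} {a c : Auction18 n Di} {e : ℝ}
    (hd : ∀ v ∈ cubeProfiles n Di, auctionDistAt18 n Di a c v ≤ e)
    {v : Profile n Di} (hv : v ∈ cubeProfiles n Di) (i : Fin n)
    {x : Fin (Di i) → ℝ} (hx : x ∈ Set.Icc (0 : Fin (Di i) → ℝ) 1) :
    |utilAt18 n Di a v i x - utilAt18 n Di c v i x| ≤ e := by
  have h := hd _ (update_mem_cube hv i hx)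
  unfold auctionDistAt18 at h
  set w := Function.update v i x with hw
  have h1 : ∑ k, |a.1 w i k - c.1 w i k| ≤ ∑ i, ∑ k, |a.1 w i k - c.1 w i k| :=
    Finset.single_le_sum (f := fun i => ∑ k, |a.1 w i k - c.1 w i k|)
      (fun j _ => Finset.sum_nonneg fun k _ => abs_nonneg _) (Finset.mem_univ i)
  have h2 : |a.2 w i - c.2 w i| ≤ ∑ i, |a.2 w i - c.2 w i| :=
    Finset.single_le_sum (f := fun i => |a.2 w i - c.2 w i|)
      (fun j _ => abs_nonneg _) (Finset.mem_univ i)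
  have h3 := dot_abs (v i) (a.1 w i) (c.1 w i) (hv i)
  unfold utilAt18
  rw [← hw]
  have h4 := abs_le.mp h3
  have h5 := abs_le.mp h2
  rw [abs_le]
  constructor <;> linarith [h4.1, h4.2, h5.1, h5.2, neg_abs_le (a.2 w i - c.2 w i),
    le_abs_self (a.2 w i - c.2 w i)]

/-- The sample regret at one sample point. -/
noncomputable def fz (n : ℕ) (Di : Fin n → ℕ) (Q : ℕ) (hQ : 1 ≤ Q) (a : Auction18 n Di)
    (i : Fin n) (z : Profile n Di × (∀ i : Fin n, Fin Q → (Fin (Di i) → ℝ))) : ℝ :=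
  (Finset.univ.sup' (Finset.univ_nonempty_iff.mpr (Fin.pos_iff_nonempty.mp hQ))
                  fun q => utilAt18 n Di a z.1 i (z.2 i q)) -
                ((∑ k, z.1 i k * a.1 z.1 i k) - a.2 z.1 i)

/-- Good sample points. -/
def goodPts (n : ℕ) (Di : Fin n → ℕ) (Q : ℕ) :
    Set (Profile n Di × (∀ i : Fin n, Fin Q → (Fin (Di i) → ℝ))) :=
  {z | z.1 ∈ cubeProfiles n Di ∧ ∀ i q, z.2 i q ∈ Set.Icc (0 : Fin (Di i) → ℝ) 1}

lemma fz_meas {n : ℕ} {Di : Fin n → ℕ} {lip : ℝ} {a : Auction18 n Di} (Q : ℕ) (hQ : 1 ≤ Q)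
    (ha : GoodAuction n Di lip a) (i : Fin n) : Measurable (fz n Di Q hQ a i) := by
  unfold fz
  have hup : ∀ q : Fin Q, Measurable
      (fun z : Profile n Di × (∀ i : Fin n, Fin Q → (Fin (Di i) → ℝ)) =>
        Function.update z.1 i (z.2 i q)) := by
    intro q
    have h : Measurable (fun z : Profile n Di × (∀ i : Fin n, Fin Q → (Fin (Di i) → ℝ)) =>
        (z.1, z.2 i q)) := by fun_prop
    exact measurable_update'.comp h
  have h1 : ∀ q : Fin Q, Measurable
      (fun z : Profile n Di × (∀ i : Fin n, Fin Q → (Fin (Di i) → ℝ)) =>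
        utilAt18 n Di a z.1 i (z.2 i q)) := by
    intro q
    unfold utilAt18
    refine Measurable.sub (Finset.measurable_sum _ fun k _ => ?_) ((ha.meas i).1.comp (hup q))
    exact Measurable.mul (by fun_prop) (((ha.meas i).2 k).comp (hup q))
  have h2 := Finset.measurable_sup' (s := (Finset.univ : Finset (Fin Q)))
    (Finset.univ_nonempty_iff.mpr (Fin.pos_iff_nonempty.mp hQ)) fun q _ => h1 q
  refine Measurable.sub ?_ (Measurable.sub (Finset.measurable_sum _ fun k _ => ?_)
    ((ha.meas i).1.comp measurable_fst))
  · convert h2 using 1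
    ext z
    simp [Finset.sup'_apply]
  · exact Measurable.mul (by fun_prop) (((ha.meas i).2 k).comp measurable_fst)

lemma fz_bound {n : ℕ} {Di : Fin n → ℕ} {lip : ℝ} {a : Auction18 n Di} (Q : ℕ) (hQ : 1 ≤ Q)
    (ha : GoodAuction n Di lip a) (i : Fin n) {z} (hz : z ∈ goodPts n Di Q) :
    fz n Di Q hQ a i z ∈ Set.Icc (-2 : ℝ) 2 := by
  unfold fz
  rw [util_truth]
  have h0 := truth_bound ha hz.1 i
  have h1 := util_bound ha hz.1 i (hz.1 i)
  have h2 : Finset.univ.sup' (Finset.univ_nonempty_iff.mpr (Fin.pos_iff_nonempty.mp hQ))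
      (fun q => utilAt18 n Di a z.1 i (z.2 i q)) ≤ 1 :=
    Finset.sup'_le _ _ fun q _ => (util_bound ha hz.1 i (hz.2 i q)).2
  have h3 : -1 ≤ Finset.univ.sup' (Finset.univ_nonempty_iff.mpr (Fin.pos_iff_nonempty.mp hQ))
      (fun q => utilAt18 n Di a z.1 i (z.2 i q)) :=
    (util_bound ha hz.1 i (hz.2 i ⟨0, hQ⟩)).1.trans
      (Finset.le_sup' (fun q => utilAt18 n Di a z.1 i (z.2 i q)) (Finset.mem_univ _))
  constructor <;> linarith

lemma fz_dist {n : ℕ} {Di : Fin n → ℕ} {a a0 c : Auction18 n Di} (Q : ℕ) (hQ : 1 ≤ Q) {e : ℝ}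
    (hd : ∀ v ∈ cubeProfiles n Di, auctionDistAt18 n Di a c v ≤ e)
    (hd0 : ∀ v ∈ cubeProfiles n Di, auctionDistAt18 n Di a0 c v ≤ e)
    (i : Fin n) {z} (hz : z ∈ goodPts n Di Q) :
    fz n Di Q hQ a0 i z ≤ fz n Di Q hQ a i z + 4 * e := by
  have key : ∀ x ∈ Set.Icc (0 : Fin (Di i) → ℝ) 1,
      |utilAt18 n Di a0 z.1 i x - utilAt18 n Di a z.1 i x| ≤ 2 * e := by
    intro x hx
    have h1 := abs_le.mp (util_dist hd hz.1 i hx)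
    have h2 := abs_le.mp (util_dist hd0 hz.1 i hx)
    rw [abs_le]
    constructor <;> linarith [h1.1, h1.2, h2.1, h2.2]
  unfold fz
  rw [util_truth, util_truth]
  have h1 : Finset.univ.sup' (Finset.univ_nonempty_iff.mpr (Fin.pos_iff_nonempty.mp hQ))
      (fun q => utilAt18 n Di a0 z.1 i (z.2 i q)) ≤
      Finset.univ.sup' (Finset.univ_nonempty_iff.mpr (Fin.pos_iff_nonempty.mp hQ))
      (fun q => utilAt18 n Di a z.1 i (z.2 i q)) + 2 * e := by
    apply Finset.sup'_le
    intro q _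
    have h2 := (abs_le.mp (key _ (hz.2 i q))).2
    have h3 := Finset.le_sup' (fun q => utilAt18 n Di a z.1 i (z.2 i q)) (Finset.mem_univ q)
    linarith
  have h4 := (abs_le.mp (key _ (hz.1 i))).1
  linarith

lemma cubeProfiles_meas (n : ℕ) (Di : Fin n → ℕ) : MeasurableSet (cubeProfiles n Di) := by
  have : cubeProfiles n Di = ⋂ i, {v | v i ∈ Set.Icc (0 : Fin (Di i) → ℝ) 1} := by
    ext v; simp [cubeProfiles]
  rw [this]
  exact MeasurableSet.iInter fun i => (measurable_pi_apply i) measurableSet_Icc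

lemma goodPts_meas (n : ℕ) (Di : Fin n → ℕ) (Q : ℕ) : MeasurableSet (goodPts n Di Q) := by
  have : goodPts n Di Q = (Prod.fst ⁻¹' cubeProfiles n Di) ∩
      ⋂ i, ⋂ q, (fun z : Profile n Di × (∀ i : Fin n, Fin Q → (Fin (Di i) → ℝ)) => z.2 i q) ⁻¹' (Set.Icc (0 : Fin (Di i) → ℝ) 1) := by
    ext v; simp [goodPts]
  rw [this]
  refine (measurable_fst (cubeProfiles_meas n Di)).inter
    (MeasurableSet.iInter fun i => MeasurableSet.iInter fun q => ?_)
  have h : Measurable (fun z : Profile n Di × (∀ i : Fin n, Fin Q → (Fin (Di i) → ℝ)) =>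
    z.2 i q) := by fun_prop
  exact h measurableSet_Icc

lemma goodPts_ae (n : ℕ) (Di : Fin n → ℕ) (Q : ℕ) (F : Measure (Profile n Di))
    [IsProbabilityMeasure F] (hF : F (cubeProfiles n Di) = 1) :
    ∀ᵐ z ∂(F.prod (sampM n Di Q)), z ∈ goodPts n Di Q := by
  have h1 : ∀ᵐ v ∂F, v ∈ cubeProfiles n Di :=
    (mem_ae_iff_prob_eq_one (cubeProfiles_meas n Di)).mpr hF
  have h2 := (Measure.quasiMeasurePreserving_fst (μ := F) (ν := sampM n Di Q)).ae h1
  have h3 := (Measure.quasiMeasurePreserving_snd (μ := F) (ν := sampM n Di Q)).ae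
    (sampM_ae n Di Q)
  filter_upwards [h2, h3] with z hz1 hz2
  exact ⟨hz1, hz2⟩

lemma fz_integrable {n : ℕ} {Di : Fin n → ℕ} {lip : ℝ} {a : Auction18 n Di} (Q : ℕ) (hQ : 1 ≤ Q)
    (F : Measure (Profile n Di))
    [IsProbabilityMeasure F] (hF : F (cubeProfiles n Di) = 1)
    (ha : GoodAuction n Di lip a) (i : Fin n) :
    Integrable (fz n Di Q hQ a i) (F.prod (sampM n Di Q)) := by
  apply Integrable.of_mem_Icc (-2) 2 (fz_meas Q hQ ha i).aemeasurable
  filter_upwards [goodPts_ae n Di Q F hF] with z hz using fz_bound Q hQ ha i hz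

lemma rgt_le {n : ℕ} {Di : Fin n → ℕ} {lip : ℝ} (hlip : 0 < lip) {a : Auction18 n Di}
    (Q : ℕ) (hQ : 1 ≤ Q)
    (F : Measure (Profile n Di))
    [IsProbabilityMeasure F] (hF : F (cubeProfiles n Di) = 1)
    (ha : GoodAuction n Di lip a) (i : Fin n) (r : ℝ)
    (hr : 1 ≤ 2 * r ∨ 0 < r ∧ ∃ D : ℕ, Di i ≤ D ∧ 1 ≤ D ∧ Real.log 2 ≤ Q * r ^ D) :
    (∫ v, (sSup (utilAt18 n Di a v i '' Set.Icc (0 : Fin (Di i) → ℝ) 1) -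
              ((∑ k, v i k * a.1 v i k) - a.2 v i)) ∂F) ≤
      (∫ z, fz n Di Q hQ a i z ∂(F.prod (sampM n Di Q))) + 4 * lip * r := by
  have hint := fz_integrable Q hQ F hF ha i
  have h1 : ∀ᵐ v ∂F, v ∈ cubeProfiles n Di :=
    (mem_ae_iff_prob_eq_one (cubeProfiles_meas n Di)).mpr hF
  rw [integral_prod _ hint]
  have hadd : (∫ v, ∫ s, fz n Di Q hQ a i (v, s) ∂(sampM n Di Q) ∂F) + 4 * lip * r =
      ∫ v, ((∫ s, fz n Di Q hQ a i (v, s) ∂(sampM n Di Q)) + 4 * lip * r) ∂F := by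
    rw [integral_add hint.integral_prod_left (integrable_const _)]
    simp
  rw [hadd]
  apply integral_mono_of_nonneg
  · filter_upwards [h1] with v hv
    rw [util_truth]
    simp only [Pi.zero_apply, sub_nonneg]
    apply le_csSup
    · refine ⟨1, ?_⟩
      rintro _ ⟨x, hx, rfl⟩
      exact (util_bound ha hv i hx).2
    · exact ⟨v i, hv i, rfl⟩
  · exact hint.integral_prod_left.add (integrable_const _)
  · filter_upwards [h1, hint.prod_right_ae] with v hv hvi
    rw [util_truth, sub_le_iff_le_add]
    apply csSup_le
    · exact ⟨_, v i, hv i, rfl⟩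
    · rintro _ ⟨x, hx, rfl⟩
      have hG : ∀ s : (∀ i : Fin n, Fin Q → (Fin (Di i) → ℝ)),
          (∀ i q, s i q ∈ Set.Icc (0 : Fin (Di i) → ℝ) 1) →
          ∀ q, (utilAt18 n Di a v i x - utilAt18 n Di a v i (v i)) - 2 * lip * ‖s i q - x‖ ≤
            fz n Di Q hQ a i (v, s) := by
        intro s hs q
        unfold fz
        rw [util_truth]
        have h3 := Finset.le_sup' (fun q => utilAt18 n Di a v i (s i q)) (Finset.mem_univ q)
        simp only at h3 ⊢
        have h4 := util_lip ha hv i hx (hs i q)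
        linarith
      have hmain : (utilAt18 n Di a v i x - utilAt18 n Di a v i (v i)) - 2 * (2 * lip) * r ≤
          ∫ s, fz n Di Q hQ a i (v, s) ∂(sampM n Di Q) := by
        rcases hr with hr | ⟨hr0, D, hD, hD1, hrQ⟩
        · have hpt : ∀ᵐ s ∂(sampM n Di Q),
              (utilAt18 n Di a v i x - utilAt18 n Di a v i (v i)) - 2 * (2 * lip) * r ≤
                fz n Di Q hQ a i (v, s) := by
            filter_upwards [sampM_ae n Di Q] with s hs
            have h2 : ‖s i ⟨0, hQ⟩ - x‖ ≤ 1 := by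
              rw [pi_norm_le_iff_of_nonneg zero_le_one]
              intro k
              have a1 := (hs i ⟨0, hQ⟩).1 k
              have a2 := (hs i ⟨0, hQ⟩).2 k
              have a3 := hx.1 k
              have a4 := hx.2 k
              simp only [Pi.zero_apply, Pi.one_apply] at a1 a2 a3 a4
              rw [Pi.sub_apply, Real.norm_eq_abs, abs_le]
              constructor <;> linarith
            have h5 := hG s hs ⟨0, hQ⟩
            have h6 : 2 * lip * ‖s i ⟨0, hQ⟩ - x‖ ≤ 2 * lip * (2 * r) :=
              mul_le_mul_of_nonneg_left (h2.trans hr) (by positivity)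
            linarith
          have := integral_mono_ae (integrable_const _) hvi hpt
          simpa using this
        · exact sampM_expect n Di Q D hQ i hD hD1 x hx r hr0 hrQ _ hvi _ (2 * lip)
            (by positivity) hG
      linarith

lemma cover_spec {n : ℕ} {Di : Fin n → ℕ} {M : Set (Auction18 n Di)} (hM : M.Nonempty) (e : ℝ)
    (h : coverNum18 n Di M e ≠ ⊤) :
    ∃ C : Finset (Auction18 n Di), (∀ a ∈ M, ∃ c ∈ C, ∀ v ∈ cubeProfiles n Di,
      auctionDistAt18 n Di a c v ≤ e) ∧ C.card ≤ (coverNum18 n Di M e).toNat ∧ 1 ≤ C.card := by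
  have h1 : coverNum18 n Di M e < coverNum18 n Di M e + 1 := by
    exact (ENat.lt_add_one_iff h).mpr le_rfl
  have h2 := h1
  rw [← ENat.natCast_toNat h] at h2
  conv_lhs at h2 => rw [ENat.natCast_toNat h]
  conv_lhs at h2 => unfold coverNum18
  simp only [iInf_lt_iff] at h2
  obtain ⟨C, hC, hc⟩ := h2
  refine ⟨C, hC, ?_, ?_⟩
  · have : C.card < (coverNum18 n Di M e).toNat + 1 := by exact_mod_cast hc
    omega
  · obtain ⟨a, ha⟩ := hM
    obtain ⟨c, hc, _⟩ := hC a ha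
    exact Finset.card_pos.mpr ⟨c, hc⟩

lemma near_max {n : ℕ} {Di : Fin n → ℕ} {lip : ℝ} {M : Set (Auction18 n Di)} (hM : M.Nonempty)
    (hgood : ∀ a ∈ M, GoodAuction n Di lip a) (Q : ℕ) (hQ : 1 ≤ Q)
    (F : Measure (Profile n Di))
    [IsProbabilityMeasure F] (hF : F (cubeProfiles n Di) = 1) (s e : ℝ) (hs : 0 < s)
    (c : Auction18 n Di) (i : Fin n) :
    ∃ a0 ∈ M, ∀ a ∈ M, (∀ v ∈ cubeProfiles n Di, auctionDistAt18 n Di a c v ≤ e) →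
      (∀ v ∈ cubeProfiles n Di, auctionDistAt18 n Di a0 c v ≤ e) ∧
      (∫ z, fz n Di Q hQ a i z ∂(F.prod (sampM n Di Q))) ≤
        (∫ z, fz n Di Q hQ a0 i z ∂(F.prod (sampM n Di Q))) + s := by
  set T : Set (Auction18 n Di) :=
    {a | a ∈ M ∧ ∀ v ∈ cubeProfiles n Di, auctionDistAt18 n Di a c v ≤ e} with hT
  set I : Auction18 n Di → ℝ := fun a => ∫ z, fz n Di Q hQ a i z ∂(F.prod (sampM n Di Q)) with hI
  by_cases hne : T.Nonempty
  · have hbdd : BddAbove (I '' T) := by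
      refine ⟨2, ?_⟩
      rintro _ ⟨a, ha, rfl⟩
      have h := integral_mono_ae (fz_integrable Q hQ F hF (hgood a ha.1) i)
        (integrable_const (2 : ℝ)) (by
          filter_upwards [goodPts_ae n Di Q F hF] with z hz
            using (fz_bound Q hQ (hgood a ha.1) i hz).2)
      simpa using h
    obtain ⟨_, ⟨a0, ha0, rfl⟩, hlt⟩ := exists_lt_of_lt_csSup (hne.image I)
      (show sSup (I '' T) - s < sSup (I '' T) by linarith)
    refine ⟨a0, ha0.1, fun a ha had => ⟨ha0.2, ?_⟩⟩
    have := le_csSup hbdd (Set.mem_image_of_mem I (show a ∈ T from ⟨ha, had⟩))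
    linarith
  · obtain ⟨a0, ha0⟩ := hM
    refine ⟨a0, ha0, fun a ha had => ?_⟩
    exact absurd ⟨a, ha, had⟩ hne

/-- Generalization bound for the sample-based (approximate) empirical regret:
with probability at least `1 − δ` over `L` i.i.d. valuation profiles from `F`
together with `Q` i.i.d. uniform misreports per bidder and profile, for every
auction in the `𝓛`-Lipschitz, individually rational class `M` and every
bidder `i`, the expected ex post regret exceeds the sample-based empirical
regret by at most `2 Δ̃_L + C √(log(n/δ)/L)`. -/
theorem stmt18 :
    ∃ C : ℝ, 0 < C ∧
      ∀ (n : ℕ), 1 ≤ n → ∀ Di : Fin n → ℕ,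
      ∀ F : Measure (Profile n Di), IsProbabilityMeasure F →
        F (cubeProfiles n Di) = 1 →
      ∀ lip : ℝ, 0 < lip →
      ∀ M : Set (Auction18 n Di),
        (∀ a ∈ M, ∀ v ∈ cubeProfiles n Di, ∀ i,
          (∀ k, 0 ≤ a.1 v i k) ∧ (∑ k, a.1 v i k) ≤ 1 ∧
          0 ≤ a.2 v i ∧ a.2 v i ≤ ∑ k, v i k * a.1 v i k) →
        (∀ a ∈ M, ∀ i : Fin n, ∀ b : Profile n Di, b ∈ cubeProfiles n Di →
          ∀ v' ∈ Set.Icc (0 : Fin (Di i) → ℝ) 1, ∀ v'' ∈ Set.Icc (0 : Fin (Di i) → ℝ) 1,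
            (∑ k, |a.1 (Function.update b i v') i k - a.1 (Function.update b i v'') i k| ≤
              lip * ‖v' - v''‖) ∧
            |a.2 (Function.update b i v') i - a.2 (Function.update b i v'') i| ≤
              lip * ‖v' - v''‖) →
        (∀ a ∈ M, ∀ i : Fin n,
          Measurable (fun v => a.2 v i) ∧ ∀ k, Measurable (fun v => a.1 v i k)) →
        (∃ ε : ℝ, 0 < ε ∧
          coverNum18 n Di M (ε / 2) ≠ ⊤ ∧ coverNum18 n Di M (ε / 4) ≠ ⊤) →
      ∀ δ : ℝ, δ ∈ Set.Ioo (0 : ℝ) 1 →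
      ∀ L Q : ℕ, 1 ≤ L → ∀ hQ : 1 ≤ Q,
      ∃ E : Set (Fin L → Profile n Di × (∀ i : Fin n, Fin Q → (Fin (Di i) → ℝ))),
        MeasurableSet E ∧
        ENNReal.ofReal (1 - δ) ≤
          (Measure.pi fun _ : Fin L =>
            F.prod (Measure.pi fun i : Fin n => Measure.pi fun _ : Fin Q =>
              Measure.pi fun _ : Fin (Di i) => volume.restrict (Set.Icc (0 : ℝ) 1))) E ∧
        ∀ ω ∈ E, ∀ a ∈ M, ∀ i : Fin n,
          (∫ v, (sSup (utilAt18 n Di a v i '' Set.Icc (0 : Fin (Di i) → ℝ) 1) -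
              ((∑ k, v i k * a.1 v i k) - a.2 v i)) ∂F) -
            (1 / (L : ℝ)) * ∑ ℓ : Fin L,
              ((Finset.univ.sup' (Finset.univ_nonempty_iff.mpr (Fin.pos_iff_nonempty.mp hQ))
                  fun q => utilAt18 n Di a (ω ℓ).1 i ((ω ℓ).2 i q)) -
                ((∑ k, (ω ℓ).1 i k * a.1 (ω ℓ).1 i k) - a.2 (ω ℓ).1 i)) ≤
            2 * DeltaTilde n Di M L Q lip δ +
              C * Real.sqrt (Real.log ((n : ℝ) / δ) / (L : ℝ)) := by
  refine ⟨5, by norm_num, ?_⟩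
  intro n hn Di F hFp hF lip hlip M hIR hLip hMeas hcov δ hδ L Q hL hQ
  obtain ⟨hδ0, hδ1⟩ := hδ
  have hgood : ∀ a ∈ M, GoodAuction n Di lip a := fun a ha =>
    ⟨hIR a ha, hLip a ha, hMeas a ha⟩
  rcases M.eq_empty_or_nonempty with hM | hM
  · refine ⟨Set.univ, MeasurableSet.univ, ?_, ?_⟩
    · rw [measure_univ]
      exact ENNReal.ofReal_le_one.mpr (by linarith)
    · intro ω _ a ha
      simp [hM] at ha
  have hn' : (1 : ℝ) ≤ n := by exact_mod_cast hn
  have hL' : (1 : ℝ) ≤ L := by exact_mod_cast hL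
  have hQ' : (1 : ℝ) ≤ Q := by exact_mod_cast hQ
  have hnδ : 1 < (n : ℝ) / δ := by
    rw [lt_div_iff₀ hδ0]; linarith
  set s := Real.sqrt (Real.log ((n : ℝ) / δ) / (L : ℝ)) with hs
  have hs0 : 0 < s := Real.sqrt_pos.mpr (div_pos (Real.log_pos hnδ) (by linarith))
  obtain ⟨_, ⟨ε, hε, hc2, hc4, rfl⟩, hlt⟩ := exists_lt_of_csInf_lt (s := {t : ℝ | ∃ ε : ℝ, 0 < ε ∧
    coverNum18 n Di M (ε / 2) ≠ ⊤ ∧ coverNum18 n Di M (ε / 4) ≠ ⊤ ∧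
    t = ε + 2 * Real.sqrt (2 * Real.log (((coverNum18 n Di M (ε / 2)).toNat : ℝ)) / (L : ℝ)) +
      2 * lip *
        (Real.log (2 * (n : ℝ) * (L : ℝ) * ((coverNum18 n Di M (ε / 4)).toNat : ℝ) / δ) /
            (Q : ℝ)) ^ ((1 : ℝ) / ((Finset.univ.sup Di : ℕ) : ℝ))})
    (by
      obtain ⟨ε, h1, h2, h3⟩ := hcov
      exact ⟨_, ε, h1, h2, h3, rfl⟩)
    (show DeltaTilde n Di M L Q lip δ < DeltaTilde n Di M L Q lip δ + s / 2 by linarith)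
  obtain ⟨C, hC, hCc, hC1⟩ := cover_spec hM _ hc2
  obtain ⟨C4, -, hCc4, hC41⟩ := cover_spec hM _ hc4
  set N2 := (coverNum18 n Di M (ε / 2)).toNat with hN2
  set N4 := (coverNum18 n Di M (ε / 4)).toNat with hN4
  have hN2' : (1 : ℝ) ≤ N2 := by exact_mod_cast hC1.trans hCc
  have hN4' : (1 : ℝ) ≤ N4 := by exact_mod_cast hC41.trans hCc4
  set D := Finset.univ.sup Di with hD
  set A := Real.log (2 * (n : ℝ) * (L : ℝ) * (N4 : ℝ) / δ) with hA
  have hA2 : Real.log 2 ≤ A := by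
    apply Real.log_le_log (by norm_num)
    rw [le_div_iff₀ hδ0]
    have h1 : (1 : ℝ) ≤ n * L * N4 := by
      have := one_le_mul_of_one_le_of_one_le hn' hL'
      exact one_le_mul_of_one_le_of_one_le this hN4'
    nlinarith
  have hA0 : 0 < A := lt_of_lt_of_le (Real.log_pos (by norm_num)) hA2
  set r := (A / (Q : ℝ)) ^ ((1 : ℝ) / (D : ℝ)) with hr
  have hrr : ∀ i, 1 ≤ 2 * r ∨ 0 < r ∧ ∃ D : ℕ, Di i ≤ D ∧ 1 ≤ D ∧ Real.log 2 ≤ Q * r ^ D := by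
    intro i
    rcases Nat.eq_zero_or_pos D with h0 | h0
    · left
      rw [hr, h0]
      norm_num
    · right
      have hAQ : 0 < A / (Q : ℝ) := div_pos hA0 (by linarith)
      refine ⟨Real.rpow_pos_of_pos hAQ _, D, Finset.le_sup (Finset.mem_univ i), h0, ?_⟩
      have : r ^ D = A / Q := by
        rw [hr, one_div, Real.rpow_inv_natCast_pow hAQ.le (by omega)]
      rw [this, mul_div_cancel₀ _ (by linarith)]
      exact hA2
  -- near maximizers
  choose a0 ha0M ha0 using near_max hM hgood Q hQ F hF s (ε / 2) hs0
  set μ := F.prod (sampM n Di Q) with hμ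
  set P := (Measure.pi fun _ : Fin L => μ) with hP
  set t := Real.sqrt (8 * Real.log (n * N2 / δ) / L) with ht
  have ht0 : 0 ≤ t := Real.sqrt_nonneg _
  have hX : 1 ≤ n * N2 / δ := by
    rw [le_div_iff₀ hδ0]
    nlinarith
  have hexp : Real.exp (-(L * t ^ 2) / 8) = δ / (n * N2) := by
    rw [ht, Real.sq_sqrt (div_nonneg (mul_nonneg (by norm_num) (Real.log_nonneg hX)) (by linarith))]
    have : -((L : ℝ) * (8 * Real.log (n * N2 / δ) / L)) / 8 = -Real.log (n * N2 / δ) := by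
      field_simp
    rw [this, Real.exp_neg, Real.exp_log (by linarith), inv_div]
  let B : Auction18 n Di × Fin n →
      Set (Fin L → Profile n Di × (∀ i : Fin n, Fin Q → (Fin (Di i) → ℝ))) := fun p =>
    {ω | L * t ≤ ∑ l, ((∫ z, fz n Di Q hQ (a0 p.1 p.2) p.2 z ∂μ) -
      fz n Di Q hQ (a0 p.1 p.2) p.2 (ω l))}
  have hBm : ∀ p, MeasurableSet (B p) := by
    intro p
    refine measurableSet_le measurable_const (Finset.measurable_sum _ fun l _ => ?_)
    exact measurable_const.sub ((fz_meas Q hQ (hgood _ (ha0M p.1 p.2)) p.2).comp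
      (measurable_pi_apply l))
  have hBP : ∀ p, P.real (B p) ≤ δ / (n * N2) := by
    intro p
    rw [← hexp]
    apply hoeff μ _ (fz_meas Q hQ (hgood _ (ha0M p.1 p.2)) p.2) _ L hL t ht0
    filter_upwards [goodPts_ae n Di Q F hF] with z hz
      using fz_bound Q hQ (hgood _ (ha0M p.1 p.2)) p.2 hz
  set U := ⋃ p ∈ (C ×ˢ (Finset.univ : Finset (Fin n))), B p with hU
  have hUm : MeasurableSet U := Finset.measurableSet_biUnion _ fun p _ => hBm p
  have hUP : P.real U ≤ δ := by
    refine (measureReal_biUnion_finset_le _ _).trans ?_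
    refine (Finset.sum_le_sum fun p _ => hBP p).trans ?_
    simp only [Finset.sum_const, Finset.card_product, Finset.card_univ, Fintype.card_fin,
      nsmul_eq_mul, Nat.cast_mul]
    have hCc' : (C.card : ℝ) ≤ N2 := by exact_mod_cast hCc
    rw [mul_div_assoc', div_le_iff₀ (by positivity)]
    have : (C.card : ℝ) * n ≤ N2 * n := mul_le_mul_of_nonneg_right hCc' (by linarith)
    nlinarith
  set G : Set (Fin L → Profile n Di × (∀ i : Fin n, Fin Q → (Fin (Di i) → ℝ))) :=
    Set.pi Set.univ fun _ => goodPts n Di Q with hG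
  have hGm : MeasurableSet G := MeasurableSet.univ_pi fun _ => goodPts_meas n Di Q
  have hGP : ∀ᵐ ω ∂P, ω ∈ G := by
    have : ∀ᵐ ω ∂P, ∀ l, ω l ∈ goodPts n Di Q := by
      rw [ae_all_iff]
      intro l
      exact (Measure.quasiMeasurePreserving_eval (fun _ : Fin L => μ) l).ae
        (goodPts_ae n Di Q F hF)
    filter_upwards [this] with ω hω
    exact fun l _ => hω l
  refine ⟨G ∩ Uᶜ, hGm.inter hUm.compl, ?_, ?_⟩
  · change ENNReal.ofReal (1 - δ) ≤ P (G ∩ Uᶜ)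
    have h1 : P (G ∩ Uᶜ) = P Uᶜ := by
      apply measure_congr
      filter_upwards [hGP] with ω hω
      apply propext
      exact ⟨fun h => h.2, fun h => ⟨hω, h⟩⟩
    rw [h1, ← ofReal_measureReal, probReal_compl_eq_one_sub hUm]
    exact ENNReal.ofReal_le_ofReal (by linarith)
  · intro ω hω a ha i
    obtain ⟨c, hcC, hac⟩ := hC a ha
    obtain ⟨h1, h2⟩ := ha0 c i a ha hac
    have h3 : ω ∉ B (c, i) := by
      intro h
      apply hω.2
      rw [hU]
      exact Set.mem_biUnion (by simp [hcC]) h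
    have h4 : ∑ l, ((∫ z, fz n Di Q hQ (a0 c i) i z ∂μ) - fz n Di Q hQ (a0 c i) i (ω l)) < L * t :=
      not_le.mp h3
    have h5 : ∑ l, fz n Di Q hQ (a0 c i) i (ω l) ≤
        ∑ l, (fz n Di Q hQ a i (ω l) + 4 * (ε / 2)) :=
      Finset.sum_le_sum fun l _ => fz_dist Q hQ hac h1 i (hω.1 l (Set.mem_univ l))
    rw [Finset.sum_sub_distrib] at h4
    rw [Finset.sum_add_distrib] at h5
    simp only [Finset.sum_const, Finset.card_univ, Fintype.card_fin, nsmul_eq_mul] at h4 h5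
    have h6 := rgt_le hlip Q hQ F hF (hgood a ha) i r (hrr i)
    change _ - (1 / (L : ℝ)) * ∑ l, fz n Di Q hQ a i (ω l) ≤ _
    have h7 : (∫ z, fz n Di Q hQ (a0 c i) i z ∂μ) - (1 / (L : ℝ)) * ∑ l, fz n Di Q hQ a i (ω l) ≤
        t + 2 * ε := by
      have hLpos : (0 : ℝ) < L := by linarith
      rw [one_div, inv_mul_eq_div, sub_le_iff_le_add, ← sub_le_iff_le_add', le_div_iff₀ hLpos]
      linarith
    have h8 : t ≤ 2 * Real.sqrt (2 * Real.log N2 / L) + 3 * s := by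
      have e1 : Real.log (n * N2 / δ) = Real.log N2 + Real.log (n / δ) := by
        rw [← Real.log_mul (by linarith) (by linarith)]
        congr 1
        ring
      have p1 : 0 ≤ Real.log N2 / L := div_nonneg (Real.log_nonneg hN2') (by linarith)
      have p2 : 0 ≤ Real.log (n / δ) / L := div_nonneg (Real.log_nonneg hnδ.le) (by linarith)
      have q1 : Real.sqrt (2 * Real.log N2 / L) ^ 2 = 2 * (Real.log N2 / L) := by
        rw [Real.sq_sqrt (by rw [mul_div_assoc]; linarith), mul_div_assoc]
      have q2 : s ^ 2 = Real.log (n / δ) / L := Real.sq_sqrt p2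
      have q0 := Real.sqrt_nonneg (2 * Real.log N2 / L)
      rw [ht]
      apply Real.sqrt_le_iff.mpr
      refine ⟨by linarith, ?_⟩
      rw [e1]
      have e2 : 8 * (Real.log N2 + Real.log (n / δ)) / L =
          8 * (Real.log N2 / L) + 8 * (Real.log (n / δ) / L) := by ring
      rw [e2, ← q2]
      have q3 := mul_nonneg q0 hs0.le
      nlinarith [sq_nonneg s]
    have h9 := Real.sqrt_nonneg (2 * Real.log N2 / L)
    linarith
end
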